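/- arXiv:2012.07129 — 4 statements merged into one kernel-verified Lean document; each statement's English description precedes it below -/
import Mathlib

section
/- Let d ≥ 1 and let R (respectively, disjoint R and B) be countable subset(s) of ℝ^d such that all Euclidean distances between distinct pairs of points (of opposite colours, in the 2-colour case) are pairwise distinct. Then a 1-colour matching of R (respectively, a 2-colour matching of R and B) is (−∞)-minimal if and only if it is stable. -/
open Set

/-- The cost function `f_γ`. -/
noncomputable def fgam (γ x : ℝ) : ℝ :=
  if 0 < γ then x ^ γ else if γ = 0 then Real.log x else -(x ^ γ)

variable {α : Type*} [MetricSpace α]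

/-- The length of an unordered pair of points. -/
noncomputable def edgeLen : Sym2 α → ℝ :=
  Sym2.lift ⟨fun x y => dist x y, fun x y => dist_comm x y⟩

/-- `M` is a 1-colour (partial) matching of `R`. -/
def IsMatch1 (R : Set α) (M : Set (Sym2 α)) : Prop :=
  (∀ e ∈ M, ¬ e.IsDiag ∧ ∀ x ∈ e, x ∈ R) ∧
  (∀ e ∈ M, ∀ e' ∈ M, ∀ x : α, x ∈ e → x ∈ e' → e = e')

/-- `x` is matched in the 1-colour matching `M`. -/
def matched1 (M : Set (Sym2 α)) (x : α) : Prop := ∃ e ∈ M, x ∈ e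

/-- Number of unmatched points of `R` in `M`. -/
noncomputable def unm1 (R : Set α) (M : Set (Sym2 α)) : ℕ :=
  {x ∈ R | ¬ matched1 M x}.ncard

/-- The total cost of a 1-colour matching. -/
noncomputable def cost1 (f : ℝ → ℝ) (M : Set (Sym2 α)) : ℝ :=
  ∑ᶠ e ∈ M, f (edgeLen e)

/-- Lexicographic comparison of (number of unmatched points, cost). -/
def lexLe (u : ℕ) (c : ℝ) (u' : ℕ) (c' : ℝ) : Prop :=
  u < u' ∨ (u = u' ∧ c ≤ c')

/-- `M` is an `f`-minimal 1-colour matching of the finite set `R`. -/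
def FinMin1 (f : ℝ → ℝ) (R : Set α) (M : Set (Sym2 α)) : Prop :=
  IsMatch1 R M ∧
  ∀ m : Set (Sym2 α), IsMatch1 R m →
    lexLe (unm1 R M) (cost1 f M) (unm1 R m) (cost1 f m)

/-- `M` is a 2-colour (partial) matching of `R` and `B`. -/
def IsMatch2 (R B : Set α) (M : Set (α × α)) : Prop :=
  (∀ e ∈ M, e.1 ∈ R ∧ e.2 ∈ B) ∧
  (∀ x y y' : α, (x, y) ∈ M → (x, y') ∈ M → y = y') ∧
  (∀ x x' y : α, (x, y) ∈ M → (x', y) ∈ M → x = x')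

/-- Number of unmatched points in a 2-colour matching. -/
noncomputable def unm2 (R B : Set α) (M : Set (α × α)) : ℕ :=
  {x ∈ R | ¬ ∃ y, (x, y) ∈ M}.ncard + {y ∈ B | ¬ ∃ x, (x, y) ∈ M}.ncard

/-- The total cost of a 2-colour matching. -/
noncomputable def cost2 (f : ℝ → ℝ) (M : Set (α × α)) : ℝ :=
  ∑ᶠ e ∈ M, f (dist e.1 e.2)

/-- `M` is an `f`-minimal 2-colour matching of the finite sets `R`, `B`. -/
def FinMin2 (f : ℝ → ℝ) (R B : Set α) (M : Set (α × α)) : Prop :=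
  IsMatch2 R B M ∧
  ∀ m : Set (α × α), IsMatch2 R B m →
    lexLe (unm2 R B M) (cost2 f M) (unm2 R B m) (cost2 f m)

/-- `R'` is compatible with the 1-colour matching `M`. -/
def Compat1 (M : Set (Sym2 α)) (R' : Set α) : Prop :=
  ∀ e ∈ M, (∃ x ∈ e, x ∈ R') → ∀ y ∈ e, y ∈ R'

/-- Restriction of a 1-colour matching to a subset of points. -/
def restr1 (M : Set (Sym2 α)) (R' : Set α) : Set (Sym2 α) :=
  {e ∈ M | ∀ x ∈ e, x ∈ R'}

/-- `M` is an `f`-minimal 1-colour matching of a (possibly infinite) set `R`. -/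
def Min1 (f : ℝ → ℝ) (R : Set α) (M : Set (Sym2 α)) : Prop :=
  IsMatch1 R M ∧
  ∀ R' : Set α, R' ⊆ R → R'.Finite → Compat1 M R' → FinMin1 f R' (restr1 M R')

/-- `(R', B')` is compatible with the 2-colour matching `M`. -/
def Compat2 (M : Set (α × α)) (R' B' : Set α) : Prop :=
  ∀ e ∈ M, (e.1 ∈ R' ∨ e.2 ∈ B') → (e.1 ∈ R' ∧ e.2 ∈ B')

/-- Restriction of a 2-colour matching. -/
def restr2 (M : Set (α × α)) (R' B' : Set α) : Set (α × α) :=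
  {e ∈ M | e.1 ∈ R' ∧ e.2 ∈ B'}

/-- `M` is an `f`-minimal 2-colour matching of possibly infinite sets `R`, `B`. -/
def Min2 (f : ℝ → ℝ) (R B : Set α) (M : Set (α × α)) : Prop :=
  IsMatch2 R B M ∧
  ∀ R' B' : Set α, R' ⊆ R → B' ⊆ B → R'.Finite → B'.Finite →
    Compat2 M R' B' → FinMin2 f R' B' (restr2 M R' B')

open Classical in
noncomputable def lens1 (M : Set (Sym2 α)) : Multiset ℝ :=
  if h : M.Finite then h.toFinset.val.map edgeLen else 0

open Classical in
noncomputable def lens2 (M : Set (α × α)) : Multiset ℝ :=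
  if h : M.Finite then h.toFinset.val.map (fun e => dist e.1 e.2) else 0

/-- Increasing rearrangement of a multiset of reals, padded with `⊥ = -∞`. -/
noncomputable def incSeq (s : Multiset ℝ) : ℕ → EReal := fun n =>
  ((s.sort (· ≤ ·)).map (fun x : ℝ => (x : EReal))).getD n ⊥

/-- Decreasing rearrangement of a multiset of reals, padded with `⊥ = -∞`. -/
noncomputable def decSeq (s : Multiset ℝ) : ℕ → EReal := fun n =>
  ((s.sort (· ≤ ·)).reverse.map (fun x : ℝ => (x : EReal))).getD n ⊥

/-- Lexicographic (non-strict) comparison of sequences. -/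
def seqLex (a b : ℕ → EReal) : Prop :=
  a = b ∨ ∃ n : ℕ, (∀ m : ℕ, m < n → a m = b m) ∧ a n < b n

/-- Lexicographic comparison of (number of unmatched points, length sequence). -/
def lexSeqLe (u : ℕ) (a : ℕ → EReal) (u' : ℕ) (b : ℕ → EReal) : Prop :=
  u < u' ∨ (u = u' ∧ seqLex a b)

/-- `M` is a `(-∞)`-minimal 1-colour matching of the finite set `R`. -/
def FinNegMin1 (R : Set α) (M : Set (Sym2 α)) : Prop :=
  IsMatch1 R M ∧ ∀ m : Set (Sym2 α), IsMatch1 R m →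
    lexSeqLe (unm1 R M) (incSeq (lens1 M)) (unm1 R m) (incSeq (lens1 m))

/-- `M` is an `∞`-minimal 1-colour matching of the finite set `R`. -/
def FinPosMin1 (R : Set α) (M : Set (Sym2 α)) : Prop :=
  IsMatch1 R M ∧ ∀ m : Set (Sym2 α), IsMatch1 R m →
    lexSeqLe (unm1 R M) (decSeq (lens1 M)) (unm1 R m) (decSeq (lens1 m))

/-- `M` is a `(-∞)`-minimal 2-colour matching of the finite sets `R`, `B`. -/
def FinNegMin2 (R B : Set α) (M : Set (α × α)) : Prop :=
  IsMatch2 R B M ∧ ∀ m : Set (α × α), IsMatch2 R B m →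
    lexSeqLe (unm2 R B M) (incSeq (lens2 M)) (unm2 R B m) (incSeq (lens2 m))

/-- `M` is an `∞`-minimal 2-colour matching of the finite sets `R`, `B`. -/
def FinPosMin2 (R B : Set α) (M : Set (α × α)) : Prop :=
  IsMatch2 R B M ∧ ∀ m : Set (α × α), IsMatch2 R B m →
    lexSeqLe (unm2 R B M) (decSeq (lens2 M)) (unm2 R B m) (decSeq (lens2 m))

/-- `M` is a `(-∞)`-minimal 1-colour matching of a (possibly infinite) set `R`. -/
def NegMin1 (R : Set α) (M : Set (Sym2 α)) : Prop :=
  IsMatch1 R M ∧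
  ∀ R' : Set α, R' ⊆ R → R'.Finite → Compat1 M R' → FinNegMin1 R' (restr1 M R')

/-- `M` is a `(-∞)`-minimal 2-colour matching of possibly infinite `R`, `B`. -/
def NegMin2 (R B : Set α) (M : Set (α × α)) : Prop :=
  IsMatch2 R B M ∧
  ∀ R' B' : Set α, R' ⊆ R → B' ⊆ B → R'.Finite → B'.Finite →
    Compat2 M R' B' → FinNegMin2 R' B' (restr2 M R' B')

/-- `x` lies strictly between `a` and `b`. -/
def btw (a b x : ℝ) : Prop := min a b < x ∧ x < max a b

/-- The four reals are pairwise distinct. -/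
def distinct4 (a b c d : ℝ) : Prop :=
  a ≠ b ∧ a ≠ c ∧ a ≠ d ∧ b ≠ c ∧ b ≠ d ∧ c ≠ d

/-- The edges `{a,b}` and `{c,d}` are entwined. -/
def EntwinedP (a b c d : ℝ) : Prop :=
  distinct4 a b c d ∧ Xor' (btw a b c) (btw a b d)

/-- The edge `{a,b}` straddles the edge `{c,d}`. -/
def StraddleP (a b c d : ℝ) : Prop := btw a b c ∧ btw a b d

/-- `M` is a `(1+)`-minimal 1-colour matching of a finite set `R ⊂ ℝ`. -/
def OnePlusMin1 (R : Set ℝ) (M : Set (Sym2 ℝ)) : Prop :=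
  FinMin1 (fgam 1) R M ∧
  ∀ a b a' b' : ℝ, s(a, b) ∈ M → s(a', b') ∈ M → ¬ StraddleP a b a' b'

/-- `M` is a `(1-)`-minimal 1-colour matching of a finite set `R ⊂ ℝ`. -/
def OneMinusMin1 (R : Set ℝ) (M : Set (Sym2 ℝ)) : Prop :=
  FinMin1 (fgam 1) R M ∧
  ∀ a b a' b' : ℝ, s(a, b) ∈ M → s(a', b') ∈ M → ¬ EntwinedP a b a' b'

/-- `M` is a `(1+)`-minimal 2-colour matching of finite sets `R, B ⊂ ℝ`. -/
def OnePlusMin2 (R B : Set ℝ) (M : Set (ℝ × ℝ)) : Prop :=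
  FinMin2 (fgam 1) R B M ∧
  ∀ e ∈ M, ∀ e' ∈ M, ¬ StraddleP e.1 e.2 e'.1 e'.2

/-- `M` is a `(1-)`-minimal 2-colour matching of finite sets `R, B ⊂ ℝ`. -/
def OneMinusMin2 (R B : Set ℝ) (M : Set (ℝ × ℝ)) : Prop :=
  FinMin2 (fgam 1) R B M ∧
  ∀ e ∈ M, ∀ e' ∈ M, ¬ EntwinedP e.1 e.2 e'.1 e'.2


/-- `M` is a stable 1-colour matching of `R`. -/
def Stable1 {α : Type*} [MetricSpace α] (R : Set α) (M : Set (Sym2 α)) : Prop :=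
  ∀ x ∈ R, ∀ y ∈ R, x ≠ y →
    (∃ e ∈ M, x ∈ e ∧ edgeLen e ≤ dist x y) ∨ (∃ e ∈ M, y ∈ e ∧ edgeLen e ≤ dist x y)

/-- `M` is a stable 2-colour matching of `R` and `B`. -/
def Stable2 {α : Type*} [MetricSpace α] (R B : Set α) (M : Set (α × α)) : Prop :=
  ∀ x ∈ R, ∀ y ∈ B,
    (∃ b, (x, b) ∈ M ∧ dist x b ≤ dist x y) ∨ (∃ r, (r, y) ∈ M ∧ dist r y ≤ dist x y)

noncomputable def lensG {E : Type*} (w : E → ℝ) (M : Set E) : Multiset ℝ :=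
  open Classical in if h : M.Finite then h.toFinset.val.map w else 0

theorem lens1_eq {α : Type*} [MetricSpace α] (M : Set (Sym2 α)) :
    lens1 M = lensG edgeLen M := rfl

theorem lens2_eq {α : Type*} [MetricSpace α] (M : Set (α × α)) :
    lens2 M = lensG (fun e => dist e.1 e.2) M := rfl

theorem mem_lensG {E : Type*} (w : E → ℝ) (M : Set E) (hM : M.Finite) (x : ℝ) :
    x ∈ lensG w M ↔ ∃ e ∈ M, w e = x := by
  unfold lensG
  rw [dif_pos hM]
  simp

theorem nodup_lensG {E : Type*} (w : E → ℝ) (M : Set E) (hw : Set.InjOn w M) :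
    (lensG w M).Nodup := by
  unfold lensG
  split_ifs with h
  · refine Multiset.Nodup.map_on ?_ h.toFinset.nodup
    intro x hx y hy hxy
    exact hw (by simpa using hx) (by simpa using hy) hxy
  · simp

theorem card_lensG {E : Type*} (w : E → ℝ) (M : Set E) (hM : M.Finite) :
    (lensG w M).card = M.ncard := by
  unfold lensG
  rw [dif_pos hM, Set.ncard_eq_toFinset_card M hM]
  simp

theorem list_lex : ∀ (l₁ l₂ : List ℝ), l₁.Pairwise (· < ·) → l₂.Pairwise (· < ·) →
    l₁.length = l₂.length → (∀ x ∈ l₂, x ∉ l₁ → ∃ y ∈ l₁, y ∉ l₂ ∧ y < x) →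
    seqLex (fun n => (l₁.map (fun x : ℝ => (x : EReal))).getD n ⊥)
      (fun n => (l₂.map (fun x : ℝ => (x : EReal))).getD n ⊥) := by
  intro l₁
  induction l₁ with
  | nil =>
    intro l₂ _ _ hl _
    have : l₂ = [] := List.length_eq_zero_iff.mp hl.symm
    subst this
    exact Or.inl rfl
  | cons a l ih =>
    intro l₂ h₁ h₂ hl h
    cases l₂ with
    | nil => simp at hl
    | cons b l' =>
      rw [List.pairwise_cons] at h₁ h₂
      rcases lt_trichotomy a b with hab | hab | hab
      · refine Or.inr ⟨0, by simp, ?_⟩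
        simpa using hab
      · subst hab
        have := ih l' h₁.2 h₂.2 (by simpa using hl) (by
          intro x hx hx'
          have hax := h₂.1 x hx
          obtain ⟨y, hy, hy', hyx⟩ := h x (by simp [hx]) (by simp [hx', hax.ne'])
          simp only [List.mem_cons, not_or] at hy hy'
          exact ⟨y, hy.resolve_left hy'.1, hy'.2, hyx⟩)
        rcases this with h0 | ⟨n, hn, hn'⟩
        · left
          funext n
          cases n with
          | zero => simp
          | succ n => simpa using congrFun h0 n
        · right
          refine ⟨n + 1, ?_, by simpa using hn'⟩
          intro k hk
          cases k with
          | zero => simp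
          | succ k => simpa using hn k (by omega)
      · exfalso
        have hb : b ∉ a :: l := by
          intro hb
          rcases List.mem_cons.mp hb with hb | hb
          · linarith
          · have := h₁.1 b hb
            linarith
        obtain ⟨y, hy, _, hyb⟩ := h b (by simp) hb
        rcases List.mem_cons.mp hy with hy | hy
        · linarith
        · have := h₁.1 y hy
          linarith

theorem sort_strict (s : Multiset ℝ) (hs : s.Nodup) : (s.sort (· ≤ ·)).Pairwise (· < ·) := by
  have h1 : (s.sort (· ≤ ·)).Pairwise (· ≤ ·) := Multiset.pairwise_sort s _
  have h2 : (s.sort (· ≤ ·)).Nodup := by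
    rw [← Multiset.coe_nodup, Multiset.sort_eq]; exact hs
  exact (h1.and h2).imp (fun h => lt_of_le_of_ne h.1 h.2)

theorem seqLex_of {E : Type*} (w : E → ℝ) (M m : Set E) (hM : M.Finite) (hm : m.Finite)
    (hw : Set.InjOn w (M ∪ m)) (hc : M.ncard = m.ncard)
    (h : ∀ e ∈ m, e ∉ M → ∃ e' ∈ M, e' ∉ m ∧ w e' ≤ w e) :
    seqLex (incSeq (lensG w M)) (incSeq (lensG w m)) := by
  refine list_lex _ _ (sort_strict _ (nodup_lensG w M (hw.mono subset_union_left)))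
    (sort_strict _ (nodup_lensG w m (hw.mono subset_union_right))) ?_ ?_
  · rw [Multiset.length_sort, Multiset.length_sort, card_lensG w M hM, card_lensG w m hm, hc]
  · intro x hx hx'
    rw [Multiset.mem_sort, mem_lensG w _ hm] at hx
    rw [Multiset.mem_sort, mem_lensG w _ hM] at hx'
    obtain ⟨e, he, rfl⟩ := hx
    have heM : e ∉ M := fun h => hx' ⟨e, h, rfl⟩
    obtain ⟨e', he', hem', hle⟩ := h e he heM
    refine ⟨w e', ?_, ?_, lt_of_le_of_ne hle ?_⟩
    · rw [Multiset.mem_sort, mem_lensG w _ hM]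
      exact ⟨e', he', rfl⟩
    · rw [Multiset.mem_sort, mem_lensG w _ hm]
      rintro ⟨f, hf, hfe⟩
      have := hw (Or.inr hf) (Or.inl he') hfe
      exact hem' (this ▸ hf)
    · intro hh
      have := hw (Or.inl he') (Or.inr he) hh
      exact heM (this ▸ he')

theorem seqLex_zero {a b : ℕ → EReal} (h : seqLex a b) : a 0 ≤ b 0 := by
  rcases h with h | ⟨n, hn, hn'⟩
  · rw [h]
  · cases n with
    | zero => exact hn'.le
    | succ n => exact (hn 0 (by omega)).le

theorem exists_le_of_seqLex (s t : Multiset ℝ) (h : seqLex (incSeq s) (incSeq t))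
    (hs : s ≠ 0) (x : ℝ) (hx : x ∈ t) : ∃ y ∈ s, y ≤ x := by
  have h0 := seqLex_zero h
  have h1 : (t.sort (· ≤ ·)).Pairwise (· ≤ ·) := Multiset.pairwise_sort t _
  have hx' : x ∈ t.sort (· ≤ ·) := (Multiset.mem_sort _).2 hx
  have hsl : ∀ y, y ∈ s.sort (· ≤ ·) → y ∈ s := fun y => (Multiset.mem_sort _).1
  unfold incSeq at h0
  have hsn : s.sort (· ≤ ·) ≠ [] := by
    intro hh
    apply hs
    rw [← Multiset.sort_eq s (· ≤ ·), hh]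
    rfl
  generalize s.sort (· ≤ ·) = l at *
  generalize t.sort (· ≤ ·) = l' at *
  cases l with
  | nil => exact absurd rfl hsn
  | cons a l =>
    cases l' with
    | nil => simp at hx'
    | cons b l' =>
      refine ⟨a, hsl a (by simp), ?_⟩
      have hab : a ≤ b := by simpa using h0
      rcases List.mem_cons.mp hx' with hb | hb
      · linarith
      · have := (List.pairwise_cons.mp h1).1 x hb
        linarith

/-- A sufficient criterion for contradiction. -/
theorem not_lex {E : Type*} (w : E → ℝ) (M m : Set E) (hM : M.Finite) (hm : m.Finite)
    (u u' : ℕ) (N : ℕ) (hu : u + 2 * M.ncard = N) (hu' : u' + 2 * m.ncard = N)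
    (e : E) (he : e ∈ m) (hlt : ∀ e' ∈ M, w e < w e')
    (hc : M.ncard ≤ m.ncard) :
    ¬ lexSeqLe u (incSeq (lensG w M)) u' (incSeq (lensG w m)) := by
  rintro (h | ⟨h, hs⟩)
  · omega
  · have hpos : 0 < m.ncard := (Set.ncard_pos hm).2 ⟨e, he⟩
    have hne : lensG w M ≠ 0 := by
      intro h0
      have := card_lensG w M hM
      rw [h0] at this
      simp at this
      omega
    obtain ⟨y, hy, hyx⟩ := exists_le_of_seqLex _ _ hs hne (w e) ((mem_lensG w m hm _).2 ⟨e, he, rfl⟩)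
    obtain ⟨e', he', rfl⟩ := (mem_lensG w M hM _).1 hy
    exact absurd (hlt e' he') (not_lt.2 hyx)

section one
variable {β : Type*} [MetricSpace β]

theorem IsMatch1.finite {R : Set β} {M : Set (Sym2 β)} (hR : R.Finite) (h : IsMatch1 R M) :
    M.Finite := by
  refine (hR.toFinset.sym2.finite_toSet).subset ?_
  intro e he
  rw [Finset.mem_coe, Finset.mem_sym2_iff]
  intro x hx
  simpa using (h.1 e he).2 x hx

theorem count1 {R : Set β} {M : Set (Sym2 β)} (hR : R.Finite) (h : IsMatch1 R M) :
    unm1 R M + 2 * M.ncard = R.ncard := by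
  classical
  have hM := h.finite hR
  have h1 : {x ∈ R | matched1 M x}.ncard = 2 * M.ncard := by
    have : {x ∈ R | matched1 M x} = ((hM.toFinset.biUnion (fun e => e.toFinset) : Finset β) : Set β) := by
      ext x
      simp only [matched1, Set.mem_setOf_eq, Finset.coe_biUnion, Set.mem_iUnion, Finset.mem_coe,
        Set.Finite.mem_toFinset, Sym2.mem_toFinset, exists_prop]
      constructor
      · exact fun hx => hx.2
      · rintro ⟨e, he, hx⟩
        exact ⟨(h.1 e he).2 x hx, e, he, hx⟩
    rw [this, Set.ncard_coe_finset, Finset.card_biUnion, Set.ncard_eq_toFinset_card M hM,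
      Finset.sum_const_nat (m := 2), mul_comm]
    · intro e he
      exact Sym2.card_toFinset_of_not_isDiag e (h.1 e (by simpa using he)).1
    · intro e he e' he' hne
      rw [Function.onFun, Finset.disjoint_left]
      intro x hx hx'
      rw [Sym2.mem_toFinset] at hx hx'
      exact hne (h.2 e (by simpa using he) e' (by simpa using he') x hx hx')
  have h2 : {x ∈ R | matched1 M x}.ncard + {x ∈ R | ¬ matched1 M x}.ncard = R.ncard := by
    rw [← Set.ncard_union_eq _ (hR.subset (Set.sep_subset _ _)) (hR.subset (Set.sep_subset _ _))]
    · congr 1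
      ext x
      simp only [Set.mem_union, Set.mem_setOf_eq]
      tauto
    · rw [Set.disjoint_left]
      rintro x ⟨_, hx⟩ ⟨_, hx'⟩
      exact hx' hx
  unfold unm1
  omega

theorem restr1_match {R R' : Set β} {M : Set (Sym2 β)} (h : IsMatch1 R M) :
    IsMatch1 R' (restr1 M R') :=
  ⟨fun e he => ⟨(h.1 e he.1).1, he.2⟩, fun e he e' he' x hx hx' => h.2 e he.1 e' he'.1 x hx hx'⟩

theorem stable_neg1 {R : Set β}
    (hd : ∀ x ∈ R, ∀ y ∈ R, ∀ x' ∈ R, ∀ y' ∈ R, x ≠ y → x' ≠ y' →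
        s(x, y) ≠ s(x', y') → dist x y ≠ dist x' y')
    {M : Set (Sym2 β)} (hM : IsMatch1 R M) (hS : Stable1 R M) : NegMin1 R M := by
  refine ⟨hM, fun R' hR' hfin hcomp => ⟨restr1_match hM, fun m hm => ?_⟩⟩
  set N := restr1 M R' with hN
  have hNm : IsMatch1 R' N := restr1_match hM
  have hNf := hNm.finite hfin
  have hmf := hm.finite hfin
  have hst : Stable1 R' N := by
    intro x hx y hy hxy
    rcases hS x (hR' hx) y (hR' hy) hxy with ⟨e, he, hxe, hl⟩ | ⟨e, he, hxe, hl⟩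
    · exact Or.inl ⟨e, ⟨he, hcomp e he ⟨x, hxe, hx⟩⟩, hxe, hl⟩
    · exact Or.inr ⟨e, ⟨he, hcomp e he ⟨y, hxe, hy⟩⟩, hxe, hl⟩
  have c1 := count1 hfin hNm
  have c2 := count1 hfin hm
  have hle : unm1 R' N ≤ 1 := by
    unfold unm1
    rw [Set.ncard_le_one (hfin.subset (Set.sep_subset _ _))]
    rintro x ⟨hx, hx'⟩ y ⟨hy, hy'⟩
    by_contra hne
    rcases hst x hx y hy hne with ⟨e, he, hxe, _⟩ | ⟨e, he, hxe, _⟩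
    · exact hx' ⟨e, he, hxe⟩
    · exact hy' ⟨e, he, hxe⟩
  by_cases hu : unm1 R' N < unm1 R' m
  · exact Or.inl hu
  refine Or.inr ⟨by omega, ?_⟩
  rw [lens1_eq, lens1_eq]
  refine seqLex_of _ _ _ hNf hmf ?_ (by omega) ?_
  · have key : ∀ e ∈ N ∪ m, ¬ e.IsDiag ∧ ∀ x ∈ e, x ∈ R := by
      rintro e (he | he)
      · exact ⟨(hNm.1 e he).1, fun x hx => hR' ((hNm.1 e he).2 x hx)⟩
      · exact ⟨(hm.1 e he).1, fun x hx => hR' ((hm.1 e he).2 x hx)⟩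
    intro e he e' he' hee
    by_contra hne
    have k := key e he
    have k' := key e' he'
    induction e with | _ x y
    induction e' with | _ x' y'
    exact hd x (k.2 x (by simp)) y (k.2 y (by simp)) x' (k'.2 x' (by simp)) y' (k'.2 y' (by simp))
      (by simpa using k.1) (by simpa using k'.1) hne hee
  · intro e he heN
    have k := hm.1 e he
    induction e with | _ x y
    rcases hst x (k.2 x (by simp)) y (k.2 y (by simp)) (by simpa using k.1) with
      ⟨e', he', hxe, hl⟩ | ⟨e', he', hxe, hl⟩
    · refine ⟨e', he', fun hem => heN ?_, hl⟩
      rw [← hm.2 e' hem _ he x hxe (by simp)]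
      exact he'
    · refine ⟨e', he', fun hem => heN ?_, hl⟩
      rw [← hm.2 e' hem _ he y hxe (by simp)]
      exact he'

theorem neg_stable1 {R : Set β} {M : Set (Sym2 β)} (hM : IsMatch1 R M) (hS : NegMin1 R M) :
    Stable1 R M := by
  classical
  intro x hx y hy hxy
  by_contra hcon
  push Not at hcon
  obtain ⟨hcx, hcy⟩ := hcon
  -- a common finishing step
  have fin : ∀ (R' : Set β) (m F : Set (Sym2 β)), R' ⊆ R → R'.Finite → F.Finite →
      IsMatch1 R' m → s(x, y) ∈ m → (∀ e ∈ F, ∀ z ∈ e, z ∈ R') →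
      (∀ z ∈ R', ∀ e ∈ M, z ∈ e → e ∈ F) →
      (∀ e ∈ F, x ∈ e ∨ y ∈ e) → F.ncard ≤ m.ncard → False := by
    intro R' m F h1 h2 hF h4 h5 h3 h8 h6 h7
    have hNm : IsMatch1 R' (restr1 M R') := restr1_match hM
    have hcomp : Compat1 M R' := by
      rintro e he ⟨z, hz, hzR⟩ w hw
      exact h3 e (h8 z hzR e he hz) w hw
    have hsub : restr1 M R' ⊆ F := by
      rintro e ⟨he, heR⟩
      have hz := e.out_fst_mem
      exact h8 _ (heR _ hz) e he hz
    refine not_lex edgeLen (restr1 M R') m (hNm.finite h2) (h4.finite h2) _ _ _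
      (count1 h2 hNm) (count1 h2 h4) s(x, y) h5 ?_ ((Set.ncard_le_ncard hsub hF).trans h7)
      ((hS.2 R' h1 h2 hcomp).2 m h4)
    intro e he
    rcases h6 e (hsub he) with h | h
    · exact hcx e he.1 h
    · exact hcy e he.1 h
  have hex : ∀ z, matched1 M z → ∃ a, s(z, a) ∈ M ∧ a ∈ R ∧ a ≠ z := by
    rintro z ⟨e, he, hz⟩
    obtain ⟨a, rfl⟩ := hz
    refine ⟨a, he, (hM.1 _ he).2 a (by simp), ?_⟩
    have := (hM.1 _ he).1
    intro h
    exact this (by simp [h])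
  have hone : IsMatch1 ({x, y} : Set β) {s(x, y)} := by
    refine ⟨?_, ?_⟩
    · rintro e rfl
      refine ⟨by simpa using hxy, ?_⟩
      intro z hz
      simpa using hz
    · rintro e rfl e' rfl _ _ _
      rfl
  have mono : ∀ {A B : Set β} {m : Set (Sym2 β)}, A ⊆ B → IsMatch1 A m → IsMatch1 B m :=
    fun hAB h => ⟨fun e he => ⟨(h.1 e he).1, fun z hz => hAB ((h.1 e he).2 z hz)⟩, h.2⟩
  have hxyM : s(x, y) ∉ M := fun h => lt_irrefl _ (hcx _ h (by simp))
  by_cases hmx : matched1 M x <;> by_cases hmy : matched1 M y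
  · obtain ⟨a, ha, haR, hax⟩ := hex x hmx
    obtain ⟨b, hb, hbR, hby⟩ := hex y hmy
    have hay : a ≠ y := by rintro rfl; exact hxyM ha
    have hbx : b ≠ x := by rintro rfl; exact hxyM (by rw [Sym2.eq_swap]; exact hb)
    have hab : a ≠ b := by
      rintro rfl
      have := hM.2 _ ha _ hb a (by simp) (by simp)
      simp [hxy, hay] at this
    refine fin {x, y, a, b} {s(x, y), s(a, b)} {s(x, a), s(y, b)} ?_ (by simp) (by simp)
      ⟨?_, ?_⟩ (by simp) ?_ ?_ ?_ ?_
    · rintro z (rfl | rfl | rfl | rfl) <;> assumption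
    · rintro e (rfl | rfl)
      · refine ⟨by simpa using hxy, fun z hz => ?_⟩
        rcases Sym2.mem_iff.1 hz with rfl | rfl <;> simp
      · refine ⟨by simpa using hab, fun z hz => ?_⟩
        rcases Sym2.mem_iff.1 hz with rfl | rfl <;> simp
    · rintro e (rfl | rfl) e' (rfl | rfl) z hz hz' <;> simp only [Sym2.mem_iff] at hz hz' <;> grind
    · rintro e (rfl | rfl) z hz <;> rcases Sym2.mem_iff.1 hz with rfl | rfl <;> simp
    · rintro z (rfl | rfl | rfl | rfl) e he hz
      · exact Or.inl (hM.2 e he _ ha z hz (by simp))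
      · exact Or.inr (hM.2 e he _ hb z hz (by simp))
      · exact Or.inl (hM.2 e he _ ha z hz (by simp))
      · exact Or.inr (hM.2 e he _ hb z hz (by simp))
    · rintro e (rfl | rfl) <;> simp
    · rw [Set.ncard_pair (a := s(x, y))]
      · exact (Set.ncard_insert_le _ _).trans (by simp)
      · simp [hax.symm, hbx.symm]
  · obtain ⟨a, ha, haR, hax⟩ := hex x hmx
    refine fin {x, y, a} {s(x, y)} {s(x, a)} ?_ (by simp) (by simp)
      (mono (by intro z; simp; tauto) hone) (by simp) ?_ ?_ (by simp) (by simp)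
    · rintro z (rfl | rfl | rfl) <;> assumption
    · rintro e rfl z hz
      rcases Sym2.mem_iff.1 hz with rfl | rfl <;> simp
    · rintro z (rfl | rfl | rfl) e he hz
      · exact hM.2 e he _ ha z hz (by simp)
      · exact absurd ⟨e, he, hz⟩ hmy
      · exact hM.2 e he _ ha z hz (by simp)
  · obtain ⟨a, ha, haR, hax⟩ := hex y hmy
    refine fin {x, y, a} {s(x, y)} {s(y, a)} ?_ (by simp) (by simp)
      (mono (by intro z; simp; tauto) hone) (by simp) ?_ ?_ (by simp) (by simp)
    · rintro z (rfl | rfl | rfl) <;> assumption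
    · rintro e rfl z hz
      rcases Sym2.mem_iff.1 hz with rfl | rfl <;> simp
    · rintro z (rfl | rfl | rfl) e he hz
      · exact absurd ⟨e, he, hz⟩ hmx
      · exact hM.2 e he _ ha z hz (by simp)
      · exact hM.2 e he _ ha z hz (by simp)
  · refine fin {x, y} {s(x, y)} ∅ ?_ (by simp) (by simp) hone (by simp) (by simp) ?_ (by simp)
      (by simp)
    · rintro z (rfl | rfl) <;> assumption
    · rintro z (rfl | rfl) e he hz
      · exact absurd ⟨e, he, hz⟩ hmx
      · exact absurd ⟨e, he, hz⟩ hmy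

end one

section two
variable {β : Type*} [MetricSpace β]

theorem IsMatch2.finite {R B : Set β} {M : Set (β × β)} (hR : R.Finite) (hB : B.Finite)
    (h : IsMatch2 R B M) : M.Finite :=
  (hR.prod hB).subset (fun e he => h.1 e he)

theorem count2R {R B : Set β} {M : Set (β × β)} (hR : R.Finite)
    (h : IsMatch2 R B M) : {x ∈ R | ¬ ∃ y, (x, y) ∈ M}.ncard + M.ncard = R.ncard := by
  have h1 : (Prod.fst '' M).ncard = M.ncard := by
    apply Set.ncard_image_of_injOn
    rintro ⟨x, y⟩ he ⟨x', y'⟩ he' hx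
    dsimp at hx
    subst hx
    rw [h.2.1 x y y' he he']
  have hsub : Prod.fst '' M ⊆ R := by
    rintro _ ⟨e, he, rfl⟩
    exact (h.1 e he).1
  have h2 : {x ∈ R | ¬ ∃ y, (x, y) ∈ M} = R \ (Prod.fst '' M) := by
    ext x
    simp
  rw [h2, ← h1]
  exact Set.ncard_sdiff_add_ncard_of_subset hsub hR

theorem IsMatch2.swap {R B : Set β} {M : Set (β × β)} (h : IsMatch2 R B M) :
    IsMatch2 B R (Prod.swap '' M) := by
  refine ⟨?_, ?_, ?_⟩
  · rintro _ ⟨e, he, rfl⟩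
    exact (h.1 e he).symm
  · intro x y y' h1 h2
    simp at h1 h2
    exact h.2.2 _ _ _ h1 h2
  · intro x y y' h1 h2
    simp at h1 h2
    exact h.2.1 _ _ _ h1 h2

theorem count2B {R B : Set β} {M : Set (β × β)} (hB : B.Finite)
    (h : IsMatch2 R B M) : {y ∈ B | ¬ ∃ x, (x, y) ∈ M}.ncard + M.ncard = B.ncard := by
  have := count2R hB h.swap
  rw [Set.ncard_image_of_injective _ Prod.swap_injective] at this
  simpa using this

theorem count2 {R B : Set β} {M : Set (β × β)} (hR : R.Finite) (hB : B.Finite)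
    (h : IsMatch2 R B M) : unm2 R B M + 2 * M.ncard = R.ncard + B.ncard := by
  have h1 := count2R hR h
  have h2 := count2B hB h
  unfold unm2
  omega

theorem restr2_match {R B R' B' : Set β} {M : Set (β × β)} (h : IsMatch2 R B M) :
    IsMatch2 R' B' (restr2 M R' B') :=
  ⟨fun _ he => he.2, fun x y y' h1 h2 => h.2.1 x y y' h1.1 h2.1,
    fun x x' y h1 h2 => h.2.2 x x' y h1.1 h2.1⟩

theorem stable_neg2 {R B : Set β}
    (hd : ∀ x ∈ R, ∀ y ∈ B, ∀ x' ∈ R, ∀ y' ∈ B, (x, y) ≠ (x', y') → dist x y ≠ dist x' y')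
    {M : Set (β × β)} (hM : IsMatch2 R B M) (hS : Stable2 R B M) : NegMin2 R B M := by
  refine ⟨hM, fun R' B' hR' hB' hfR hfB hcomp => ⟨restr2_match hM, fun m hm => ?_⟩⟩
  set N := restr2 M R' B' with hN
  have hNm : IsMatch2 R' B' N := restr2_match hM
  have hNf := hNm.finite hfR hfB
  have hmf := hm.finite hfR hfB
  have hst : Stable2 R' B' N := by
    intro x hx y hy
    rcases hS x (hR' hx) y (hB' hy) with ⟨b, hb, hl⟩ | ⟨b, hb, hl⟩
    · exact Or.inl ⟨b, ⟨hb, hcomp _ hb (Or.inl hx)⟩, hl⟩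
    · exact Or.inr ⟨b, ⟨hb, hcomp _ hb (Or.inr hy)⟩, hl⟩
  have c1 := count2 hfR hfB hNm
  have c2 := count2 hfR hfB hm
  have r1 := count2R hfR hNm
  have r2 := count2R hfR hm
  have b1 := count2B hfB hNm
  have b2 := count2B hfB hm
  have hle : {x ∈ R' | ¬ ∃ y, (x, y) ∈ N}.ncard = 0 ∨ {y ∈ B' | ¬ ∃ x, (x, y) ∈ N}.ncard = 0 := by
    by_contra hcon
    replace hcon := not_or.1 hcon
    obtain ⟨x, hx, hx'⟩ := Set.nonempty_of_ncard_ne_zero hcon.1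
    obtain ⟨y, hy, hy'⟩ := Set.nonempty_of_ncard_ne_zero hcon.2
    rcases hst x hx y hy with ⟨b, hb, _⟩ | ⟨b, hb, _⟩
    · exact hx' ⟨b, hb⟩
    · exact hy' ⟨b, hb⟩
  by_cases hu : unm2 R' B' N < unm2 R' B' m
  · exact Or.inl hu
  refine Or.inr ⟨by omega, ?_⟩
  rw [lens2_eq, lens2_eq]
  refine seqLex_of _ _ _ hNf hmf ?_ (by omega) ?_
  · have key : ∀ e ∈ N ∪ m, e.1 ∈ R ∧ e.2 ∈ B := by
      rintro e (he | he)
      · exact ⟨hR' (hNm.1 e he).1, hB' (hNm.1 e he).2⟩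
      · exact ⟨hR' (hm.1 e he).1, hB' (hm.1 e he).2⟩
    intro e he e' he' hee
    by_contra hne
    exact hd e.1 (key e he).1 e.2 (key e he).2 e'.1 (key e' he').1 e'.2 (key e' he').2 hne hee
  · rintro ⟨x, y⟩ he heN
    rcases hst x (hm.1 _ he).1 y (hm.1 _ he).2 with ⟨b, hb, hl⟩ | ⟨b, hb, hl⟩
    · refine ⟨(x, b), hb, fun hem => heN ?_, hl⟩
      rw [← hm.2.1 _ _ _ hem he]
      exact hb
    · refine ⟨(b, y), hb, fun hem => heN ?_, hl⟩
      rw [← hm.2.2 _ _ _ hem he]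
      exact hb

theorem neg_stable2 {R B : Set β} {M : Set (β × β)} (hM : IsMatch2 R B M) (hS : NegMin2 R B M) :
    Stable2 R B M := by
  classical
  intro x hx y hy
  by_contra hcon
  push Not at hcon
  obtain ⟨hcx, hcy⟩ := hcon
  have fin : ∀ (R' B' : Set β) (m F : Set (β × β)), R' ⊆ R → B' ⊆ B → R'.Finite → B'.Finite →
      F.Finite → IsMatch2 R' B' m → (x, y) ∈ m → (∀ e ∈ F, e.1 ∈ R' ∧ e.2 ∈ B') →
      (∀ e ∈ M, e.1 ∈ R' ∨ e.2 ∈ B' → e ∈ F) →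
      (∀ e ∈ F, e.1 = x ∨ e.2 = y) → F.ncard ≤ m.ncard → False := by
    intro R' B' m F h1 h1' h2 h2' hF h4 h5 h3 h8 h6 h7
    have hNm : IsMatch2 R' B' (restr2 M R' B') := restr2_match hM
    have hcomp : Compat2 M R' B' := fun e he h => h3 e (h8 e he h)
    have hsub : restr2 M R' B' ⊆ F := fun e he => h8 e he.1 (Or.inl he.2.1)
    refine not_lex (fun e : β × β => dist e.1 e.2) (restr2 M R' B') m (hNm.finite h2 h2')
      (h4.finite h2 h2') _ _ _
      (count2 h2 h2' hNm) (count2 h2 h2' h4) (x, y) h5 ?_ ((Set.ncard_le_ncard hsub hF).trans h7)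
      ((hS.2 R' B' h1 h1' h2 h2' hcomp).2 m h4)
    rintro ⟨p, q⟩ he
    rcases h6 _ (hsub he) with h | h
    · dsimp at h
      subst h
      exact hcx q he.1
    · dsimp at h
      subst h
      exact hcy p he.1
  have hone : ∀ {A C : Set β}, x ∈ A → y ∈ C → IsMatch2 A C {(x, y)} := by
    intro A C hA hC
    refine ⟨?_, ?_, ?_⟩
    · rintro e rfl
      exact ⟨hA, hC⟩
    · intro p q q' h h'
      simp at h h'
      rw [h.2, h'.2]
    · intro p q q' h h'
      simp at h h'
      rw [h.1, h'.1]
  by_cases hmx : ∃ a, (x, a) ∈ M <;> by_cases hmy : ∃ b, (b, y) ∈ M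
  · obtain ⟨a, ha⟩ := hmx
    obtain ⟨b, hb⟩ := hmy
    have haB := (hM.1 _ ha).2
    have hbR := (hM.1 _ hb).1
    have hay : a ≠ y := by rintro rfl; exact lt_irrefl _ (hcx _ ha)
    have hbx : b ≠ x := by rintro rfl; exact lt_irrefl _ (hcy _ hb)
    refine fin {x, b} {y, a} {(x, y), (b, a)} {(x, a), (b, y)} ?_ ?_ (by simp) (by simp) (by simp)
      ⟨?_, ?_, ?_⟩ (by simp) ?_ ?_ ?_ ?_
    · rintro z (rfl | rfl) <;> assumption
    · rintro z (rfl | rfl) <;> assumption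
    · rintro e (rfl | rfl) <;> simp
    · intro p q q' h h'
      simp at h h'
      grind
    · intro p q q' h h'
      simp at h h'
      grind
    · rintro e (rfl | rfl) <;> simp
    · rintro ⟨p, q⟩ he ((rfl | rfl) | (rfl | rfl))
      · exact Or.inl (by rw [hM.2.1 _ _ _ he ha])
      · exact Or.inr (by rw [hM.2.1 _ _ _ he hb]; rfl)
      · exact Or.inr (by rw [hM.2.2 _ _ _ he hb]; rfl)
      · exact Or.inl (by rw [hM.2.2 _ _ _ he ha])
    · rintro e (rfl | rfl) <;> simp
    · rw [Set.ncard_pair (a := (x, y))]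
      · exact (Set.ncard_insert_le _ _).trans (by simp)
      · simp [hbx.symm]
  · obtain ⟨a, ha⟩ := hmx
    have haB := (hM.1 _ ha).2
    refine fin {x} {y, a} {(x, y)} {(x, a)} (by simpa using hx) ?_ (by simp) (by simp) (by simp)
      (hone (by simp) (by simp)) (by simp) (by simp) ?_ (by simp) (by simp)
    · rintro z (rfl | rfl) <;> assumption
    · rintro ⟨p, q⟩ he (rfl | (rfl | rfl))
      · rw [hM.2.1 _ _ _ he ha]; rfl
      · exact absurd ⟨_, he⟩ hmy
      · rw [hM.2.2 _ _ _ he ha]; rfl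
  · obtain ⟨b, hb⟩ := hmy
    have hbR := (hM.1 _ hb).1
    refine fin {x, b} {y} {(x, y)} {(b, y)} ?_ (by simpa using hy) (by simp) (by simp) (by simp)
      (hone (by simp) (by simp)) (by simp) (by simp) ?_ (by simp) (by simp)
    · rintro z (rfl | rfl) <;> assumption
    · rintro ⟨p, q⟩ he ((rfl | rfl) | rfl)
      · exact absurd ⟨_, he⟩ hmx
      · rw [hM.2.1 _ _ _ he hb]; rfl
      · rw [hM.2.2 _ _ _ he hb]; rfl
  · refine fin {x} {y} {(x, y)} ∅ (by simpa using hx) (by simpa using hy) (by simp) (by simp)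
      (by simp) (hone (by simp) (by simp)) (by simp) (by simp) ?_ (by simp) (by simp)
    rintro ⟨p, q⟩ he (rfl | rfl)
    · exact absurd ⟨_, he⟩ hmx
    · exact absurd ⟨_, he⟩ hmy

end two

/-- For countable subsets of `ℝ^d` with pairwise distinct distances, a matching is
`(-∞)`-minimal if and only if it is stable (both 1-colour and 2-colour cases). -/
theorem stmt_1 (d : ℕ) (hd : 1 ≤ d) :
    (∀ R : Set (EuclideanSpace ℝ (Fin d)), R.Countable →
      (∀ x ∈ R, ∀ y ∈ R, ∀ x' ∈ R, ∀ y' ∈ R, x ≠ y → x' ≠ y' →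
        s(x, y) ≠ s(x', y') → dist x y ≠ dist x' y') →
      ∀ M : Set (Sym2 (EuclideanSpace ℝ (Fin d))), IsMatch1 R M →
        (NegMin1 R M ↔ Stable1 R M)) ∧
    (∀ R B : Set (EuclideanSpace ℝ (Fin d)), R.Countable → B.Countable → Disjoint R B →
      (∀ x ∈ R, ∀ y ∈ B, ∀ x' ∈ R, ∀ y' ∈ B, (x, y) ≠ (x', y') → dist x y ≠ dist x' y') →
      ∀ M : Set (EuclideanSpace ℝ (Fin d) × EuclideanSpace ℝ (Fin d)), IsMatch2 R B M →
        (NegMin2 R B M ↔ Stable2 R B M)) := by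
  exact ⟨fun R _ hd M hM => ⟨neg_stable1 hM, stable_neg1 hd hM⟩,
    fun R B _ _ _ hd M hM => ⟨neg_stable2 hM, stable_neg2 hd hM⟩⟩
end

section
/- Fix d ≥ 1, γ ∈ ℝ, and n ≥ 1, and let m and m' be two partial matchings of the index set {1,…,n} (i.e., sets of pairwise disjoint unordered pairs of indices). If (d,γ) ≠ (1,1) and m ≠ m', then the set of configurations (x_1,…,x_n) ∈ (ℝ^d)^n with x_1,…,x_n pairwise distinct for which Σ_{{i,j}∈m} f_γ(|x_i − x_j|) = Σ_{{i,j}∈m'} f_γ(|x_i − x_j|) has Lebesgue measure zero in (ℝ^d)^n. If (d,γ) = (1,1), the same conclusion holds provided the set of indices matched by m differs from the set of indices matched by m'. -/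
/-- `m` is a partial matching of the index set `{1,…,n}`: a set of pairwise
disjoint unordered pairs of distinct indices. -/
def IsIndexMatch (n : ℕ) (m : Set (Sym2 (Fin n))) : Prop :=
  (∀ e ∈ m, ¬ e.IsDiag) ∧
  (∀ e ∈ m, ∀ e' ∈ m, ∀ i : Fin n, i ∈ e → i ∈ e' → e = e')

/-- The `f_γ`-cost of the matching `m` on the configuration `x`. -/
noncomputable def ecost (d n : ℕ) (γ : ℝ) (x : Fin n → EuclideanSpace ℝ (Fin d))
    (m : Set (Sym2 (Fin n))) : ℝ :=
  ∑ᶠ e ∈ m, fgam γ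
    (Sym2.lift ⟨fun i j => dist (x i) (x j), fun i j => dist_comm (x i) (x j)⟩ e)

open MeasureTheory Filter Topology

lemma null_of_dir {V : Type*} [NormedAddCommGroup V] [NormedSpace ℝ V] [MeasurableSpace V]
    [BorelSpace V] [LocallyCompactSpace V] (μ : Measure V) [μ.IsAddHaarMeasure]
    (S : Set V) (hS : MeasurableSet S) (v : V) (G : V → ℝ)
    (h : ∀ x ∈ S, G x = 0 ∧ ∃ D : ℝ, D ≠ 0 ∧ HasDerivAt (fun t : ℝ => G (x + t • v)) D 0) :
    μ S = 0 := by
  have key := ae_mem_of_ae_add_linearMap_mem (LinearMap.toSpanSingleton ℝ V v)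
    (volume : Measure ℝ) μ hS.compl ?_
  · rw [ae_iff] at key
    simpa using key
  intro y
  rw [ae_iff]
  simp only [Set.mem_compl_iff, not_not, LinearMap.toSpanSingleton_apply]
  apply Set.Countable.measure_zero
  set T : Set ℝ := {t : ℝ | y + t • v ∈ S} with hT
  have : DiscreteTopology T := by
    rw [discreteTopology_subtype_iff]
    intro t ht
    obtain ⟨_, D, hD, hd⟩ := h _ ht
    have h2 : HasDerivAt (fun s : ℝ => G (y + s • v)) D t := by
      have h3 : HasDerivAt (fun s : ℝ => G ((y + t • v) + s • v)) D (t - t) := by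
        simpa using hd
      have h4 := h3.comp_sub_const t t
      refine h4.congr_of_eventuallyEq (Eventually.of_forall fun s => ?_)
      simp only
      congr 1
      module
    have h5 := h2.eventually_ne (c := 0) hD
    rw [← Filter.empty_mem_iff_bot, mem_inf_principal]
    filter_upwards [h5] with s hs hs'
    exact hs (h _ hs').1
  have : Countable T := TopologicalSpace.separableSpace_iff_countable.1 inferInstance
  exact Set.to_countable T

lemma meas_fgam (γ : ℝ) : Measurable (fgam γ) := by
  unfold fgam
  split_ifs
  · exact measurable_id.pow_const γ
  · exact Real.measurable_log
  · exact (measurable_id.pow_const γ).neg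

lemma deriv_fgam (γ : ℝ) : ∃ c : ℝ, c ≠ 0 ∧ ∀ r : ℝ, 0 < r →
    HasDerivAt (fgam γ) (c * r ^ (γ - 1)) r := by
  rcases lt_trichotomy γ 0 with h | h | h
  · refine ⟨-γ, by linarith, fun r hr => ?_⟩
    have : fgam γ = fun x => -(x ^ γ) := by
      funext x; simp [fgam, h.not_gt, h.ne]
    rw [this, neg_mul]
    exact (Real.hasDerivAt_rpow_const (Or.inl hr.ne')).neg
  · refine ⟨1, one_ne_zero, fun r hr => ?_⟩
    have : fgam γ = Real.log := by
      funext x; simp [fgam, h]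
    rw [this, h, one_mul, zero_sub, Real.rpow_neg_one]
    exact Real.hasDerivAt_log hr.ne'
  · refine ⟨γ, h.ne', fun r hr => ?_⟩
    have : fgam γ = fun x => (x ^ γ) := by
      funext x; simp [fgam, h]
    rw [this]
    exact Real.hasDerivAt_rpow_const (Or.inl hr.ne')

lemma deriv_norm {d : ℕ} (u : EuclideanSpace ℝ (Fin d)) (hu : u ≠ 0) (p : Fin d) :
    HasDerivAt (fun t : ℝ => ‖u + t • EuclideanSpace.single p (1:ℝ)‖) (u p / ‖u‖) 0 := by
  have h1 : HasDerivAt (fun t : ℝ => u + t • EuclideanSpace.single p (1:ℝ))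
      (EuclideanSpace.single p (1:ℝ)) 0 := by
    simpa using ((hasDerivAt_id (0:ℝ)).smul_const (EuclideanSpace.single p (1:ℝ))).const_add u
  have h2 := h1.norm_sq
  have hn : ‖u‖ ≠ 0 := norm_ne_zero_iff.2 hu
  have z : u + (0:ℝ) • EuclideanSpace.single p (1:ℝ) = u := by rw [zero_smul, add_zero]
  rw [z] at h2
  have h3 := h2.sqrt (by simpa using hu)
  have e : (fun t : ℝ => ‖u + t • EuclideanSpace.single p (1:ℝ)‖) =
    fun y => √(‖u + y • EuclideanSpace.single p (1:ℝ)‖ ^ 2) := by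
    funext t; simp [Real.sqrt_sq]
  rw [e]
  convert h3 using 1
  rw [z, EuclideanSpace.inner_single_right, Real.sqrt_sq (norm_nonneg _)]
  simp
  field_simp

lemma ecost_congr {d n : ℕ} (γ : ℝ) (m : Set (Sym2 (Fin n))) (i : Fin n)
    (hi : ∀ e ∈ m, i ∉ e) (x y : Fin n → EuclideanSpace ℝ (Fin d)) (h : ∀ l, l ≠ i → x l = y l) :
    ecost d n γ x m = ecost d n γ y m := by
  unfold ecost
  refine finsum_mem_congr rfl fun e he => ?_
  have := hi e he
  induction e using Sym2.ind with
  | _ a b =>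
    simp only [Sym2.mem_iff, not_or] at this
    simp only [Sym2.lift_mk]
    rw [h a (Ne.symm this.1), h b (Ne.symm this.2)]

lemma ecost_split {d n : ℕ} (γ : ℝ) (m : Set (Sym2 (Fin n))) (i j : Fin n)
    (he : s(i, j) ∈ m) (x : Fin n → EuclideanSpace ℝ (Fin d)) :
    ecost d n γ x m = fgam γ (dist (x i) (x j)) + ecost d n γ x (m \ {s(i,j)}) := by
  unfold ecost
  have : m = insert s(i,j) (m \ {s(i,j)}) := by simp [Set.insert_eq_of_mem he]
  conv_lhs => rw [this]
  rw [finsum_mem_insert _ (by simp) (Set.toFinite _)]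
  simp

lemma meas_ecost {d n : ℕ} (γ : ℝ) (m : Set (Sym2 (Fin n))) :
    Measurable (fun x => ecost d n γ x m) := by
  unfold ecost
  simp_rw [finsum_mem_eq_finite_toFinset_sum _ (Set.toFinite m)]
  refine Finset.measurable_sum _ fun e _ => ?_
  apply (meas_fgam γ).comp
  induction e using Sym2.ind with
  | _ a b =>
    simp only [Sym2.lift_mk]
    fun_prop

lemma meas_inj {d n : ℕ} :
    MeasurableSet {x : Fin n → EuclideanSpace ℝ (Fin d) | Function.Injective x} := by
  have : {x : Fin n → EuclideanSpace ℝ (Fin d) | Function.Injective x} =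
    ⋂ a, ⋂ b, {x | x a = x b → a = b} := by ext; simp [Function.Injective]
  rw [this]
  refine MeasurableSet.iInter fun a => MeasurableSet.iInter fun b => ?_
  by_cases h : a = b
  · simp [h]
  · simp only [h, imp_false]
    exact (measurableSet_eq_fun (by fun_prop) (by fun_prop)).compl

/-- the term of the edge `ij`, differentiated in direction `x_i`, coordinate `p` -/
lemma deriv_term {d n : ℕ} (γ c : ℝ) (hc : ∀ r : ℝ, 0 < r →
    HasDerivAt (fgam γ) (c * r ^ (γ - 1)) r) (x : Fin n → EuclideanSpace ℝ (Fin d)) (i j : Fin n)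
    (hij : i ≠ j) (hx : x i ≠ x j) (p : Fin d) :
    HasDerivAt (fun t : ℝ => fgam γ (dist
      ((x + t • Pi.single (M := fun _ => EuclideanSpace ℝ (Fin d)) i (EuclideanSpace.single p (1:ℝ))) i)
      ((x + t • Pi.single (M := fun _ => EuclideanSpace ℝ (Fin d)) i (EuclideanSpace.single p (1:ℝ))) j)))
      (c * (dist (x i) (x j) ^ (γ - 1) * ((x i p - x j p) / dist (x i) (x j)))) 0 := by
  have hu : x i - x j ≠ 0 := sub_ne_zero.2 hx
  have h1 := deriv_norm (x i - x j) hu p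
  have h2 := HasDerivAt.comp (0:ℝ) (h₂ := fgam γ) (by simpa using hc _ (norm_pos_iff.2 hu)) h1
  refine (h2.congr_deriv ?_).congr_of_eventuallyEq (Eventually.of_forall fun t => ?_)
  · simp [dist_eq_norm]; ring
  · simp [dist_eq_norm, hij.symm, add_sub_right_comm]

lemma hasDeriv_ecost {d n : ℕ} (γ c : ℝ) (hc : ∀ r : ℝ, 0 < r →
    HasDerivAt (fgam γ) (c * r ^ (γ - 1)) r) (m : Set (Sym2 (Fin n))) (hm : IsIndexMatch n m)
    (x : Fin n → EuclideanSpace ℝ (Fin d)) (i j : Fin n) (he : s(i, j) ∈ m)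
    (hx : Function.Injective x) (p : Fin d) :
    HasDerivAt (fun t : ℝ => ecost d n γ (x + t • Pi.single
      (M := fun _ => EuclideanSpace ℝ (Fin d)) i (EuclideanSpace.single p (1:ℝ))) m)
      (c * (dist (x i) (x j) ^ (γ - 1) * ((x i p - x j p) / dist (x i) (x j)))) 0 := by
  have hij : i ≠ j := by
    have := hm.1 _ he
    simpa using this
  have h1 := (deriv_term γ c hc x i j hij (hx.ne hij) p).add_const
    (ecost d n γ x (m \ {s(i,j)}))
  refine h1.congr_of_eventuallyEq (Eventually.of_forall fun t => ?_)
  simp only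
  rw [ecost_split γ m i j he]
  congr 1
  apply ecost_congr γ _ i
  · rintro e ⟨he1, he2⟩ hie
    exact he2 (hm.2 _ he1 _ he i hie (by simp))
  · intro l hl
    simp [hl]

lemma hasDeriv_ecost' {d n : ℕ} (γ : ℝ) (m : Set (Sym2 (Fin n)))
    (x : Fin n → EuclideanSpace ℝ (Fin d)) (i : Fin n) (he : ∀ e ∈ m, i ∉ e) (p : Fin d) :
    HasDerivAt (fun t : ℝ => ecost d n γ (x + t • Pi.single
      (M := fun _ => EuclideanSpace ℝ (Fin d)) i (EuclideanSpace.single p (1:ℝ))) m) 0 0 := by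
  refine (hasDerivAt_const (0:ℝ) (ecost d n γ x m)).congr_of_eventuallyEq
    (Eventually.of_forall fun t => ?_)
  apply ecost_congr γ _ i he
  intro l hl
  simp [hl]

lemma general_null {d n : ℕ} (γ : ℝ) (m m' : Set (Sym2 (Fin n))) (i : Fin n)
    (D : Fin d → (Fin n → EuclideanSpace ℝ (Fin d)) → ℝ) (hD : ∀ p, Measurable (D p))
    (B : Set (Fin n → EuclideanSpace ℝ (Fin d))) (hB : volume B = 0)
    (hder : ∀ p x, Function.Injective x → HasDerivAt (fun t : ℝ =>
      ecost d n γ (x + t • Pi.single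
        (M := fun _ => EuclideanSpace ℝ (Fin d)) i (EuclideanSpace.single p (1:ℝ))) m -
      ecost d n γ (x + t • Pi.single
        (M := fun _ => EuclideanSpace ℝ (Fin d)) i (EuclideanSpace.single p (1:ℝ))) m') (D p x) 0)
    (hne : ∀ x, Function.Injective x → x ∉ B → ∃ p, D p x ≠ 0) :
    volume {x : Fin n → EuclideanSpace ℝ (Fin d) |
        Function.Injective x ∧ ecost d n γ x m = ecost d n γ x m'} = 0 := by
  refine measure_mono_null (t := B ∪ ⋃ p, {x | (Function.Injective x ∧
    ecost d n γ x m = ecost d n γ x m') ∧ D p x ≠ 0}) ?_ ?_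
  · rintro x ⟨hx, h⟩
    by_cases hb : x ∈ B
    · exact Or.inl hb
    · obtain ⟨p, hp⟩ := hne x hx hb
      exact Or.inr (Set.mem_iUnion.2 ⟨p, ⟨hx, h⟩, hp⟩)
  · refine measure_union_null hB (measure_iUnion_null fun p => ?_)
    refine null_of_dir volume _ ?_ (Pi.single i (EuclideanSpace.single p (1:ℝ)))
      (fun x => ecost d n γ x m - ecost d n γ x m') ?_
    · exact (meas_inj.inter (measurableSet_eq_fun (meas_ecost γ m) (meas_ecost γ m'))).inter
        (measurableSet_eq_fun (hD p) measurable_const).compl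
    · rintro x ⟨⟨hx, h⟩, hp⟩
      exact ⟨sub_eq_zero.2 h, _, hp, hder p x hx⟩

lemma bad_null {d n : ℕ} (i j k : Fin n) (hji : j ≠ i) (hjk : j ≠ k) (p q : Fin d) (hpq : p ≠ q) :
    volume {x : Fin n → EuclideanSpace ℝ (Fin d) | x i p - x k p ≠ 0 ∧
      (x i p - x j p) * (x i q - x k q) - (x i q - x j q) * (x i p - x k p) = 0} = 0 := by
  refine null_of_dir volume _ ?_ (Pi.single j (EuclideanSpace.single q (1:ℝ)))
      (fun x => (x i p - x j p) * (x i q - x k q) - (x i q - x j q) * (x i p - x k p)) ?_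
  · exact (measurableSet_eq_fun (by fun_prop) measurable_const).compl.inter
      (measurableSet_eq_fun (by fun_prop) measurable_const)
  · rintro x ⟨h1, h2⟩
    refine ⟨h2, _, h1, ?_⟩
    have h := ((hasDerivAt_id (0:ℝ)).mul_const (x i p - x k p))
    rw [one_mul] at h
    refine h.congr_of_eventuallyEq (Eventually.of_forall fun t => ?_)
    simp [hji.symm, hjk.symm, hpq]
    linarith

lemma core_unmatched {d n : ℕ} (γ : ℝ) (m m' : Set (Sym2 (Fin n))) (hm : IsIndexMatch n m)
    (i j : Fin n) (he : s(i, j) ∈ m) (hi : ∀ e ∈ m', i ∉ e) :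
    volume {x : Fin n → EuclideanSpace ℝ (Fin d) |
        Function.Injective x ∧ ecost d n γ x m = ecost d n γ x m'} = 0 := by
  obtain ⟨c, hc0, hc⟩ := deriv_fgam γ
  have hij : i ≠ j := by
    have := hm.1 _ he
    simpa using this
  refine general_null γ m m' i (fun p x =>
    c * (dist (x i) (x j) ^ (γ - 1) * ((x i p - x j p) / dist (x i) (x j)))) ?_ ∅ (by simp) ?_ ?_
  · intro p
    have h1 : Measurable fun x : Fin n → EuclideanSpace ℝ (Fin d) =>
      dist (x i) (x j) ^ (γ - 1) := Measurable.pow_const (by fun_prop) _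
    fun_prop
  · intro p x hx
    exact ((hasDeriv_ecost γ c hc m hm x i j he hx p).sub
      (hasDeriv_ecost' γ m' x i hi p)).congr_deriv (sub_zero _)
  · intro x hx _
    have hne := hx.ne hij
    by_contra! hcon
    apply hne
    ext p
    have h := hcon p
    have hd : 0 < dist (x i) (x j) := dist_pos.2 hne
    have h3 := (Real.rpow_pos_of_pos hd (γ - 1)).ne'
    simp only [mul_eq_zero, div_eq_zero_iff, hc0, h3, hd.ne', false_or, or_false] at h
    linarith

lemma core_matched {d n : ℕ} (γ : ℝ) (hdg : ¬ (d = 1 ∧ γ = 1)) (m m' : Set (Sym2 (Fin n)))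
    (hm : IsIndexMatch n m) (hm' : IsIndexMatch n m')
    (i j k : Fin n) (he : s(i, j) ∈ m) (he' : s(i, k) ∈ m') (hjk : j ≠ k) :
    volume {x : Fin n → EuclideanSpace ℝ (Fin d) |
        Function.Injective x ∧ ecost d n γ x m = ecost d n γ x m'} = 0 := by
  obtain ⟨c, hc0, hc⟩ := deriv_fgam γ
  have hij : i ≠ j := by
    have := hm.1 _ he
    simpa using this
  have hik : i ≠ k := by
    have := hm'.1 _ he'
    simpa using this
  refine general_null γ m m' i (fun p x =>
    c * (dist (x i) (x j) ^ (γ - 1) * ((x i p - x j p) / dist (x i) (x j))) -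
    c * (dist (x i) (x k) ^ (γ - 1) * ((x i p - x k p) / dist (x i) (x k)))) ?_
    (⋃ p, ⋃ q, ⋃ _ : p ≠ q, {x : Fin n → EuclideanSpace ℝ (Fin d) | x i p - x k p ≠ 0 ∧
      (x i p - x j p) * (x i q - x k q) - (x i q - x j q) * (x i p - x k p) = 0}) ?_ ?_ ?_
  · intro p
    have h1 : Measurable fun x : Fin n → EuclideanSpace ℝ (Fin d) =>
      dist (x i) (x j) ^ (γ - 1) := Measurable.pow_const (by fun_prop) _
    have h2 : Measurable fun x : Fin n → EuclideanSpace ℝ (Fin d) =>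
      dist (x i) (x k) ^ (γ - 1) := Measurable.pow_const (by fun_prop) _
    fun_prop
  · exact measure_iUnion_null fun p => measure_iUnion_null fun q => measure_iUnion_null fun h =>
      bad_null i j k hij.symm hjk p q h
  · intro p x hx
    exact (hasDeriv_ecost γ c hc m hm x i j he hx p).sub
      (hasDeriv_ecost γ c hc m' hm' x i k he' hx p)
  · intro x hx hB
    by_contra! hcon
    have hr : 0 < dist (x i) (x j) := dist_pos.2 (hx.ne hij)
    have hs : 0 < dist (x i) (x k) := dist_pos.2 (hx.ne hik)
    have hru : ‖x i - x j‖ = dist (x i) (x j) := (dist_eq_norm _ _).symm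
    have hsw : ‖x i - x k‖ = dist (x i) (x k) := (dist_eq_norm _ _).symm
    set r := dist (x i) (x j)
    set s := dist (x i) (x k)
    have hA : 0 < r ^ (γ - 1) := Real.rpow_pos_of_pos hr _
    have hA' : 0 < s ^ (γ - 1) := Real.rpow_pos_of_pos hs _
    have hvec : ∀ p, (r ^ (γ - 1) / r) * (x i p - x j p) = (s ^ (γ - 1) / s) * (x i p - x k p) := by
      intro p
      have h := hcon p
      rw [← mul_sub, mul_eq_zero, or_iff_right hc0, sub_eq_zero] at h
      rw [div_mul_eq_mul_div, div_mul_eq_mul_div, ← mul_div_assoc, ← mul_div_assoc] at *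
      exact h
    have hv : (r ^ (γ - 1) / r) • (x i - x j) = (s ^ (γ - 1) / s) • (x i - x k) := by
      ext p
      simpa using hvec p
    have hn := congrArg norm hv
    rw [norm_smul, norm_smul, hru, hsw, Real.norm_of_nonneg (by positivity),
      Real.norm_of_nonneg (by positivity), div_mul_cancel₀ _ hr.ne',
      div_mul_cancel₀ _ hs.ne'] at hn
    by_cases hg : γ = 1
    · have hd1 : d ≠ 1 := fun h => hdg ⟨h, hg⟩
      have : ∃ p, x i p - x k p ≠ 0 := by
        by_contra! h
        apply hx.ne hik
        ext p
        linarith [h p]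
      obtain ⟨p, hp⟩ := this
      have : ∃ q, p ≠ q := by
        by_contra! h
        apply hd1
        have := p.2
        by_contra h1
        have e1 := h ⟨0, by omega⟩
        have e2 := h ⟨1, by omega⟩
        have e3 := e1.symm.trans e2
        simp at e3
      obtain ⟨q, hq⟩ := this
      apply hB
      simp only [Set.mem_iUnion]
      refine ⟨p, q, hq, hp, ?_⟩
      have h1 := hvec p
      have h2 := hvec q
      have h0 : r ^ (γ - 1) / r ≠ 0 := by positivity
      apply (mul_eq_zero.1 (?_ : (r ^ (γ - 1) / r) * _ = 0)).resolve_left h0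
      linear_combination (x i q - x k q) * h1 - (x i p - x k p) * h2
    · have hrs : r = s :=
        (Real.rpow_left_inj hr.le hs.le (sub_ne_zero.2 hg)).1 hn
      rw [hrs] at hv
      have h0 : s ^ (γ - 1) / s ≠ 0 := by positivity
      have := smul_right_injective _ h0 hv
      exact hx.ne hjk (sub_right_injective this)

lemma core_one {d n : ℕ} (γ : ℝ) (hdg : ¬ (d = 1 ∧ γ = 1)) (m m' : Set (Sym2 (Fin n)))
    (hm : IsIndexMatch n m) (hm' : IsIndexMatch n m') (e : Sym2 (Fin n)) (he : e ∈ m)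
    (he' : e ∉ m') :
    volume {x : Fin n → EuclideanSpace ℝ (Fin d) |
        Function.Injective x ∧ ecost d n γ x m = ecost d n γ x m'} = 0 := by
  induction e using Sym2.ind with
  | _ i j =>
    by_cases h : ∃ e ∈ m', i ∈ e
    · obtain ⟨e, h1, k, rfl⟩ := h
      refine core_matched γ hdg m m' hm hm' i j k he h1 ?_
      rintro rfl
      exact he' h1
    · push Not at h
      exact core_unmatched γ m m' hm i j he h

lemma core_two {d n : ℕ} (γ : ℝ) (m m' : Set (Sym2 (Fin n)))
    (hm : IsIndexMatch n m) (i : Fin n) (h : ∃ e ∈ m, i ∈ e) (h' : ¬ ∃ e ∈ m', i ∈ e) :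
    volume {x : Fin n → EuclideanSpace ℝ (Fin d) |
        Function.Injective x ∧ ecost d n γ x m = ecost d n γ x m'} = 0 := by
  obtain ⟨e, h1, k, rfl⟩ := h
  push Not at h'
  exact core_unmatched γ m m' hm i k h1 h'

/-- Local uniqueness: if `(d,γ) ≠ (1,1)` and `m ≠ m'`, then the set of injective
configurations on which the two matchings have equal cost is Lebesgue-null; if
`(d,γ) = (1,1)` the same holds provided the matched index sets differ. -/
theorem stmt_2 (d : ℕ) (hd : 1 ≤ d) (γ : ℝ) (n : ℕ) (hn : 1 ≤ n)
    (m m' : Set (Sym2 (Fin n))) (hm : IsIndexMatch n m) (hm' : IsIndexMatch n m') :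
    (¬(d = 1 ∧ γ = 1) → m ≠ m' →
      MeasureTheory.volume {x : Fin n → EuclideanSpace ℝ (Fin d) |
        Function.Injective x ∧ ecost d n γ x m = ecost d n γ x m'} = 0) ∧
    (d = 1 → γ = 1 →
      {i : Fin n | ∃ e ∈ m, i ∈ e} ≠ {i : Fin n | ∃ e ∈ m', i ∈ e} →
      MeasureTheory.volume {x : Fin n → EuclideanSpace ℝ (Fin d) |
        Function.Injective x ∧ ecost d n γ x m = ecost d n γ x m'} = 0) := by
  constructor
  · intro hdg hne
    by_cases h : ∃ e ∈ m, e ∉ m'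
    · obtain ⟨e, h1, h2⟩ := h
      exact core_one γ hdg m m' hm hm' e h1 h2
    · by_cases h' : ∃ e ∈ m', e ∉ m
      · obtain ⟨e, h1, h2⟩ := h'
        have := core_one γ hdg m' m hm' hm e h1 h2
        simpa only [eq_comm] using this
      · push Not at h h'
        exact absurd (Set.Subset.antisymm h h') hne
  · intro _ _ hne
    by_cases h : ∃ i, (∃ e ∈ m, i ∈ e) ∧ ¬ ∃ e ∈ m', i ∈ e
    · obtain ⟨i, h1, h2⟩ := h
      exact core_two γ m m' hm i h1 h2
    · by_cases h' : ∃ i, (∃ e ∈ m', i ∈ e) ∧ ¬ ∃ e ∈ m, i ∈ e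
      · obtain ⟨i, h1, h2⟩ := h'
        have := core_two (d := d) γ m' m hm' i h1 h2
        simpa only [eq_comm] using this
      · exfalso
        apply hne
        ext i
        exact ⟨fun a => by_contra fun b => h ⟨i, a, b⟩, fun a => by_contra fun b => h' ⟨i, a, b⟩⟩
end

section
/- Let d = 1 and let R (respectively, disjoint R and B) be finite subset(s) of ℝ, and suppose that there is a unique (1+)-minimal matching M. Then there exists ε > 0 such that for all μ ∈ (1, 1+ε), M is the unique μ-minimal matching. The analogous statement holds for a unique (1−)-minimal matching and μ ∈ (1−ε, 1). -/
open Set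

variable {α : Type*} [MetricSpace α]

open Filter Topology in
theorem core7 {X : Type*} (S : Set X) (hS : S.Finite) (hne : S.Nonempty) (u : X → ℕ)
    (c : ℝ → X → ℝ) (hc : ∀ m ∈ S, ContinuousAt (fun μ => c μ m) 1) (Good : X → Prop)
    (I : Set ℝ)
    (hI : ∀ μ ∈ I, ∀ m, (m ∈ S ∧ ∀ m', m' ∈ S → lexLe (u m) (c μ m) (u m') (c μ m')) → Good m)
    (M : X)
    (huniq : ∀ M', (M' ∈ S ∧ ∀ m', m' ∈ S → lexLe (u M') (c 1 M') (u m') (c 1 m')) ∧ Good M' →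
      M' = M) :
    ∃ ε : ℝ, 0 < ε ∧ ∀ μ ∈ I, |μ - 1| < ε →
      (M ∈ S ∧ ∀ m', m' ∈ S → lexLe (u M) (c μ M) (u m') (c μ m')) ∧
      ∀ M', (M' ∈ S ∧ ∀ m', m' ∈ S → lexLe (u M') (c μ M') (u m') (c μ m')) → M' = M := by
  have h1 : ∀ᶠ μ in 𝓝 (1:ℝ), ∀ m ∈ S, ∀ m' ∈ S, c 1 m' < c 1 m → c μ m' < c μ m := by
    rw [eventually_all_finite hS]
    intro m hm
    rw [eventually_all_finite hS]
    intro m' hm'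
    by_cases h : c 1 m' < c 1 m
    · filter_upwards [(hc m' hm').eventually_lt (hc m hm) h] with μ hμ _ using hμ
    · exact Eventually.of_forall fun μ h' => absurd h' h
  obtain ⟨ε, hε, h2⟩ := Metric.eventually_nhds_iff.1 h1
  refine ⟨ε, hε, fun μ hμ hμε => ?_⟩
  have h3 := h2 (y := μ) (by rwa [Real.dist_eq])
  have key : ∀ M', (M' ∈ S ∧ ∀ m', m' ∈ S → lexLe (u M') (c μ M') (u m') (c μ m')) → M' = M := by
    intro M' hM'
    refine huniq M' ⟨⟨hM'.1, fun m' hm' => ?_⟩, hI μ hμ M' hM'⟩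
    rcases hM'.2 m' hm' with h | ⟨h, h'⟩
    · exact Or.inl h
    · refine Or.inr ⟨h, ?_⟩
      by_contra hcon
      exact absurd (h3 M' hM'.1 m' hm' (not_le.1 hcon)) (not_lt.2 h')
  refine ⟨?_, key⟩
  obtain ⟨N, hN, hmin⟩ := Set.exists_min_image S (fun m => toLex (u m, c μ m)) hS hne
  have hNmin : (N ∈ S ∧ ∀ m', m' ∈ S → lexLe (u N) (c μ N) (u m') (c μ m')) := by
    refine ⟨hN, fun m' hm' => ?_⟩
    have := hmin m' hm'
    rw [Prod.Lex.le_iff] at this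
    exact this
  have := key N hNmin
  subst this
  exact hNmin

theorem conv7 {μ p q L l : ℝ} (hμ : 1 < μ) (hp : 0 ≤ p) (hq : 0 ≤ q) (hl : 0 ≤ l)
    (hpL : p < L) (hqL : q < L) (hs : p + q ≤ L + l) :
    p ^ μ + q ^ μ < L ^ μ + l ^ μ := by
  have mono : ∀ {x y : ℝ}, 0 ≤ x → x ≤ y → x ^ μ ≤ y ^ μ := fun hx hxy =>
    Real.rpow_le_rpow hx hxy (by linarith)
  have smono : ∀ {x y : ℝ}, 0 ≤ x → x < y → x ^ μ < y ^ μ := fun hx hxy =>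
    Real.rpow_lt_rpow hx hxy (by linarith)
  rcases le_or_gt p l with h | h
  · linarith [mono hp h, smono hq hqL]
  have hc := strictConvexOn_rpow hμ
  obtain ⟨_, hc2⟩ := hc
  have h7 := fun (x y : ℝ) hx hy hne (a b : ℝ) ha hb hab =>
    @hc2 x hx y hy hne a b ha hb hab
  have hLl : 0 < L - l := by linarith
  have e1 := h7 l L (Set.mem_Ici.2 hl) (Set.mem_Ici.2 (by linarith)) (by linarith)
    ((L - p) / (L - l)) ((p - l) / (L - l)) (div_pos (by linarith) hLl)
    (div_pos (by linarith) hLl) (by field_simp; ring)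
  have e2 := h7 l L (Set.mem_Ici.2 hl) (Set.mem_Ici.2 (by linarith)) (by linarith)
    ((p - l) / (L - l)) ((L - p) / (L - l)) (div_pos (by linarith) hLl)
    (div_pos (by linarith) hLl) (by field_simp; ring)
  simp only [smul_eq_mul] at e1 e2
  have f1 : (L - p) / (L - l) * l + (p - l) / (L - l) * L = p := by field_simp; ring
  have f2 : (p - l) / (L - l) * l + (L - p) / (L - l) * L = L + l - p := by field_simp; ring
  have f3 : (L - p) / (L - l) = 1 - (p - l) / (L - l) := by field_simp; ring
  rw [f1] at e1
  rw [f2] at e2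
  rw [f3] at e1 e2
  have := mono hq (show q ≤ L + l - p by linarith)
  linarith

theorem conc7 {μ p L l X : ℝ} (hμ0 : 0 < μ) (hμ : μ < 1) (hp : 0 ≤ p)
    (hpL : p < L) (hpl : p < l) (hs : p + X = L + l) :
    X ^ μ + p ^ μ < L ^ μ + l ^ μ := by
  have hc := Real.strictConcaveOn_rpow hμ0 hμ
  obtain ⟨_, hc2⟩ := hc
  have h7 := fun (x y : ℝ) hx hy hne (a b : ℝ) ha hb hab =>
    @hc2 x hx y hy hne a b ha hb hab
  have hLl : 0 < X - p := by linarith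
  have e1 := h7 p X (Set.mem_Ici.2 hp) (Set.mem_Ici.2 (by linarith)) (by linarith)
    ((X - L) / (X - p)) ((L - p) / (X - p)) (div_pos (by linarith) hLl)
    (div_pos (by linarith) hLl) (by field_simp; ring)
  have e2 := h7 p X (Set.mem_Ici.2 hp) (Set.mem_Ici.2 (by linarith)) (by linarith)
    ((L - p) / (X - p)) ((X - L) / (X - p)) (div_pos (by linarith) hLl)
    (div_pos (by linarith) hLl) (by field_simp; ring)
  simp only [smul_eq_mul] at e1 e2
  have f1 : (X - L) / (X - p) * p + (L - p) / (X - p) * X = L := by field_simp; ring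
  have f2 : (L - p) / (X - p) * p + (X - L) / (X - p) * X = l := by
    have : l = p + X - L := by linarith
    rw [this]; field_simp; ring
  have f3 : (X - L) / (X - p) = 1 - (L - p) / (X - p) := by field_simp; ring
  rw [f1] at e1
  rw [f2] at e2
  rw [f3] at e1 e2
  linarith

theorem fgam_pos7 {μ : ℝ} (h : 0 < μ) (x : ℝ) : fgam μ x = x ^ μ := by simp [fgam, h]

theorem straddle7 {a b c d μ : ℝ} (h : StraddleP a b c d) (hμ : 1 < μ) :
    fgam μ (dist a d) + fgam μ (dist c b) < fgam μ (dist a b) + fgam μ (dist c d) := by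
  simp only [fgam_pos7 (show 0 < μ by linarith), Real.dist_eq]
  obtain ⟨⟨h1, h2⟩, h3, h4⟩ := h
  apply conv7 hμ (abs_nonneg _) (abs_nonneg _) (abs_nonneg _)
  all_goals
    rcases le_total a b with hab | hab <;>
      simp only [min_eq_left, min_eq_right, max_eq_left, max_eq_right, hab] at h1 h2 h3 h4 <;>
      grind

theorem entwined7 {a b c d μ : ℝ} (h : EntwinedP a b c d) (hμ0 : 0 < μ) (hμ : μ < 1) :
    fgam μ (dist a d) + fgam μ (dist c b) < fgam μ (dist a b) + fgam μ (dist c d) := by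
  simp only [fgam_pos7 hμ0, Real.dist_eq]
  obtain ⟨⟨h1, h2, h3, h4, h5, h6⟩, h7⟩ := h
  have smono : ∀ {x y : ℝ}, 0 ≤ x → x < y → x ^ μ < y ^ μ := fun hx hxy =>
    Real.rpow_lt_rpow hx hxy hμ0
  have cases7 : (|c - b| < |a - b| ∧ |c - b| < |c - d| ∧ |c - b| + |a - d| = |a - b| + |c - d|) ∨
      (|a - d| < |a - b| ∧ |a - d| < |c - d| ∧ |a - d| + |c - b| = |a - b| + |c - d|) ∨
      (|a - d| < |a - b| ∧ |c - b| < |c - d|) ∨ (|a - d| < |c - d| ∧ |c - b| < |a - b|) := by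
    simp only [Xor', _root_.btw] at h7
    rcases lt_or_gt_of_ne h1 with hab | hab <;>
      simp only [min_eq_left, min_eq_right, max_eq_left, max_eq_right, hab.le] at h7 <;>
      grind
  rcases cases7 with ⟨x, y, z⟩ | ⟨x, y, z⟩ | ⟨x, y⟩ | ⟨x, y⟩
  · exact conc7 hμ0 hμ (abs_nonneg _) x y z
  · linarith [conc7 hμ0 hμ (abs_nonneg _) x y z]
  · linarith [smono (abs_nonneg _) x, smono (abs_nonneg _) y]
  · linarith [smono (abs_nonneg _) x, smono (abs_nonneg _) y]

theorem sum7 {E : Type*} {F : Set E} (hF : F.Finite) (g h : E → ℝ) {e e' : E} (he : e ∈ F)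
    (he' : e' ∈ F) (hne : e ≠ e') (heq : ∀ x ∈ F, x ≠ e → x ≠ e' → g x = h x)
    (hlt : g e + g e' < h e + h e') : (∑ᶠ x ∈ F, g x) < ∑ᶠ x ∈ F, h x := by
  classical
  rw [finsum_mem_eq_finite_toFinset_sum _ hF, finsum_mem_eq_finite_toFinset_sum _ hF]
  have a1 : e ∈ hF.toFinset := by simpa using he
  have a2 : e' ∈ hF.toFinset.erase e := by simpa using ⟨hne.symm, he'⟩
  rw [← Finset.add_sum_erase _ _ a1, ← Finset.add_sum_erase _ h a1,
    ← Finset.add_sum_erase _ _ a2, ← Finset.add_sum_erase _ h a2]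
  have : ∑ x ∈ (hF.toFinset.erase e).erase e', g x = ∑ x ∈ (hF.toFinset.erase e).erase e', h x := by
    apply Finset.sum_congr rfl
    intro x hx
    simp at hx
    exact heq x hx.2.2 hx.2.1 hx.1
  linarith

theorem contsum7 {E : Type*} {F : Set E} (hF : F.Finite) (g : E → ℝ) :
    ContinuousAt (fun μ => ∑ᶠ x ∈ F, fgam μ (g x)) 1 := by
  have h : ContinuousAt (fun μ : ℝ => ∑ x ∈ hF.toFinset, (g x) ^ μ) 1 := by
    refine tendsto_finsetSum _ fun x _ => ?_
    exact Real.continuousAt_const_rpow' one_ne_zero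
  refine h.congr ?_
  filter_upwards [lt_mem_nhds (show (0:ℝ) < 1 by norm_num)] with μ hμ
  rw [finsum_mem_eq_finite_toFinset_sum _ hF]
  simp [fgam_pos7 hμ]

theorem fin17 {R : Set ℝ} (hR : R.Finite) : {e : Sym2 ℝ | ∀ x ∈ e, x ∈ R}.Finite := by
  refine ((hR.prod hR).image (fun p : ℝ × ℝ => s(p.1, p.2))).subset ?_
  intro e
  induction e with | _ x y =>
  intro h
  simp at h
  exact ⟨(x, y), ⟨h.1, h.2⟩, rfl⟩

theorem improve17 {R : Set ℝ} (hR : R.Finite) {m : Set (Sym2 ℝ)} (hm : IsMatch1 R m)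
    {a b c d : ℝ} (h1 : s(a, b) ∈ m) (h2 : s(c, d) ∈ m) (hne : s(a, b) ≠ s(c, d)) (f : ℝ → ℝ)
    (hlt : f (dist a d) + f (dist c b) < f (dist a b) + f (dist c d)) : ¬ FinMin1 f R m := by
  rintro ⟨-, hmin⟩
  have hfin : m.Finite := (fin17 hR).subset fun e he => (hm.1 e he).2
  set σ := Equiv.swap b d with hσ
  have hab : a ≠ b := by simpa using (hm.1 _ h1).1
  have hcd : c ≠ d := by simpa using (hm.1 _ h2).1
  have sep : ∀ x ∈ s(a, b), x ∉ s(c, d) := fun x hx hx' => hne (hm.2 _ h1 _ h2 x hx hx')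
  have hb : b ∈ R := (hm.1 _ h1).2 b (by simp)
  have hd : d ∈ R := (hm.1 _ h2).2 d (by simp)
  have sa := sep a (by simp)
  have sb := sep b (by simp)
  simp at sa sb
  have hσR : ∀ x, σ x ∈ R ↔ x ∈ R := by
    intro x
    rcases eq_or_ne x b with rfl | hxb
    · simp [hσ, hb, hd]
    rcases eq_or_ne x d with rfl | hxd
    · simp [hσ, hb, hd]
    rw [hσ, Equiv.swap_apply_of_ne_of_ne hxb hxd]
  have hinj : Function.Injective (Sym2.map σ) := Sym2.map.injective σ.injective
  have hσσ : ∀ x, σ (σ x) = x := fun x => Equiv.swap_apply_self _ _ x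
  have hm' : IsMatch1 R (Sym2.map σ '' m) := by
    constructor
    · rintro _ ⟨e, he, rfl⟩
      refine ⟨?_, ?_⟩
      · have := (hm.1 e he).1
        induction e with | _ x y => simpa using this
      · intro x hx
        obtain ⟨y, hy, rfl⟩ := Sym2.mem_map.1 hx
        exact (hσR y).2 ((hm.1 e he).2 y hy)
    · rintro _ ⟨e, he, rfl⟩ _ ⟨e', he', rfl⟩ x hx hx'
      obtain ⟨y, hy, rfl⟩ := Sym2.mem_map.1 hx
      obtain ⟨z, hz, hzy⟩ := Sym2.mem_map.1 hx'
      rw [σ.injective hzy] at hz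
      rw [hm.2 e he e' he' y hy hz]
  have hmat : ∀ x, matched1 (Sym2.map σ '' m) (σ x) ↔ matched1 m x := by
    intro x
    constructor
    · rintro ⟨_, ⟨e, he, rfl⟩, hx⟩
      obtain ⟨y, hy, hyx⟩ := Sym2.mem_map.1 hx
      rw [σ.injective hyx] at hy
      exact ⟨e, he, hy⟩
    · rintro ⟨e, he, hx⟩
      exact ⟨_, ⟨e, he, rfl⟩, Sym2.mem_map.2 ⟨x, hx, rfl⟩⟩
  have hu : unm1 R (Sym2.map σ '' m) = unm1 R m := by
    unfold unm1
    rw [← Set.ncard_image_of_injective {x ∈ R | ¬ matched1 m x} σ.injective]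
    congr 1
    ext x
    constructor
    · rintro ⟨hx, hx'⟩
      refine ⟨σ x, ⟨(hσR x).2 hx, ?_⟩, hσσ x⟩
      rw [← hmat, hσσ]; exact hx'
    · rintro ⟨y, ⟨hy, hy'⟩, rfl⟩
      exact ⟨(hσR y).2 hy, by rw [hmat]; exact hy'⟩
  have hcost : cost1 f (Sym2.map σ '' m) < cost1 f m := by
    unfold cost1
    rw [finsum_mem_image hinj.injOn]
    apply sum7 hfin _ _ h1 h2 hne
    · intro e he n1 n2
      have nb : b ∉ e := fun hx => n1 (hm.2 _ he _ h1 b hx (by simp))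
      have nd : d ∉ e := fun hx => n2 (hm.2 _ he _ h2 d hx (by simp))
      have : Sym2.map σ e = e := by
        induction e with | _ x y =>
        simp at nb nd
        rw [Sym2.map_mk, hσ, Equiv.swap_apply_of_ne_of_ne (Ne.symm nb.1) (Ne.symm nd.1),
          Equiv.swap_apply_of_ne_of_ne (Ne.symm nb.2) (Ne.symm nd.2)]
      rw [this]
    · have e1 : σ a = a := Equiv.swap_apply_of_ne_of_ne hab sa.2
      have e2 : σ c = c := Equiv.swap_apply_of_ne_of_ne (Ne.symm sb.1) hcd
      have e3 : σ b = d := Equiv.swap_apply_left _ _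
      have e4 : σ d = b := Equiv.swap_apply_right _ _
      simp only [Sym2.map_mk, e1, e2, e3, e4]
      exact hlt
  rcases hmin _ hm' with h | ⟨_, h⟩
  · omega
  · linarith

theorem improve27 {R B : Set ℝ} (hR : R.Finite) (hB : B.Finite) {m : Set (ℝ × ℝ)}
    (hm : IsMatch2 R B m)
    {a b c d : ℝ} (h1 : (a, b) ∈ m) (h2 : (c, d) ∈ m) (hbd : b ≠ d) (f : ℝ → ℝ)
    (hlt : f (dist a d) + f (dist c b) < f (dist a b) + f (dist c d)) : ¬ FinMin2 f R B m := by
  rintro ⟨-, hmin⟩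
  have hfin : m.Finite := (hR.prod hB).subset fun e he => hm.1 e he
  set σ := Equiv.swap b d with hσ
  have hb : b ∈ B := (hm.1 _ h1).2
  have hd : d ∈ B := (hm.1 _ h2).2
  have hσR : ∀ x, σ x ∈ B ↔ x ∈ B := by
    intro x
    rcases eq_or_ne x b with rfl | hxb
    · simp [hσ, hb, hd]
    rcases eq_or_ne x d with rfl | hxd
    · simp [hσ, hb, hd]
    rw [hσ, Equiv.swap_apply_of_ne_of_ne hxb hxd]
  have hσσ : ∀ x, σ (σ x) = x := fun x => Equiv.swap_apply_self _ _ x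
  set T : ℝ × ℝ → ℝ × ℝ := fun e => (e.1, σ e.2) with hT
  have hinj : Function.Injective T := by
    rintro ⟨x, y⟩ ⟨x', y'⟩ h
    simpa [hT] using h
  have hmem : ∀ x y, (x, y) ∈ T '' m ↔ (x, σ y) ∈ m := by
    intro x y
    constructor
    · rintro ⟨⟨x', y'⟩, he, h⟩
      simp only [hT, Prod.mk.injEq] at h
      rw [← h.1, ← h.2, hσσ]; exact he
    · intro h
      exact ⟨_, h, by simp [hT, hσσ]⟩
  have hm' : IsMatch2 R B (T '' m) := by
    refine ⟨?_, ?_, ?_⟩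
    · rintro _ ⟨e, he, rfl⟩
      exact ⟨(hm.1 e he).1, (hσR _).2 (hm.1 e he).2⟩
    · intro x y y' h h'
      rw [hmem] at h h'
      exact σ.injective (hm.2.1 _ _ _ h h')
    · intro x x' y h h'
      rw [hmem] at h h'
      exact hm.2.2 _ _ _ h h'
  have hu : unm2 R B (T '' m) = unm2 R B m := by
    unfold unm2
    congr 1
    · congr 1
      ext x
      simp only [Set.mem_setOf_eq, hmem]
      refine and_congr_right fun _ => not_congr ⟨?_, ?_⟩
      · rintro ⟨y, h⟩; exact ⟨_, h⟩
      · rintro ⟨y, h⟩; exact ⟨σ y, by rw [hσσ]; exact h⟩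
    · rw [← Set.ncard_image_of_injective {y ∈ B | ¬ ∃ x, (x, y) ∈ m} σ.injective]
      congr 1
      ext y
      simp only [hmem]
      constructor
      · rintro ⟨hx, hx'⟩
        exact ⟨σ y, ⟨(hσR y).2 hx, hx'⟩, hσσ y⟩
      · rintro ⟨z, ⟨hy, hy'⟩, rfl⟩
        exact ⟨(hσR z).2 hy, by rw [hσσ]; exact hy'⟩
  have hcost : cost2 f (T '' m) < cost2 f m := by
    unfold cost2
    rw [finsum_mem_image hinj.injOn]
    apply sum7 hfin _ _ h1 h2 (fun h => hbd (Prod.mk.inj h).2)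
    · rintro ⟨x, y⟩ he n1 n2
      have nb : y ≠ b := by
        rintro rfl; exact n1 (by rw [hm.2.2 _ _ _ he h1])
      have nd : y ≠ d := by
        rintro rfl; exact n2 (by rw [hm.2.2 _ _ _ he h2])
      simp only [hT, hσ, Equiv.swap_apply_of_ne_of_ne nb nd]
    · have e3 : σ b = d := Equiv.swap_apply_left _ _
      have e4 : σ d = b := Equiv.swap_apply_right _ _
      simp only [hT, e3, e4]
      exact hlt
  rcases hmin _ hm' with h | ⟨_, h⟩
  · omega
  · linarith

theorem straddle_ne7 {a b c d : ℝ} (h : StraddleP a b c d) : s(a, b) ≠ s(c, d) ∧ b ≠ d := by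
  obtain ⟨⟨h1, h2⟩, h3, h4⟩ := h
  constructor
  · intro h
    rcases Sym2.eq_iff.1 h with ⟨rfl, rfl⟩ | ⟨rfl, rfl⟩ <;> grind
  · rintro rfl; grind

theorem entwined_ne7 {a b c d : ℝ} (h : EntwinedP a b c d) : s(a, b) ≠ s(c, d) ∧ b ≠ d := by
  obtain ⟨⟨h1, h2, h3, h4, h5, h6⟩, h7⟩ := h
  refine ⟨?_, h5⟩
  intro h
  rcases Sym2.eq_iff.1 h with ⟨rfl, rfl⟩ | ⟨rfl, rfl⟩ <;> simp_all

theorem main17 {R : Set ℝ} (hR : R.Finite) (P : ℝ → ℝ → ℝ → ℝ → Prop) (I : Set ℝ)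
    (hP : ∀ a b c d, P a b c d → s(a, b) ≠ s(c, d) ∧ ∀ μ ∈ I,
      fgam μ (dist a d) + fgam μ (dist c b) < fgam μ (dist a b) + fgam μ (dist c d))
    (M : Set (Sym2 ℝ))
    (hu : ∀ M', (FinMin1 (fgam 1) R M' ∧
      ∀ a b a' b' : ℝ, s(a, b) ∈ M' → s(a', b') ∈ M' → ¬ P a b a' b') → M' = M) :
    ∃ ε : ℝ, 0 < ε ∧ ∀ μ ∈ I, |μ - 1| < ε →
      FinMin1 (fgam μ) R M ∧ ∀ M', FinMin1 (fgam μ) R M' → M' = M := by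
  refine core7 {m | IsMatch1 R m} ?_ ⟨∅, by simp [IsMatch1]⟩ (unm1 R) (fun μ m => cost1 (fgam μ) m)
    ?_ (fun M' => ∀ a b a' b' : ℝ, s(a, b) ∈ M' → s(a', b') ∈ M' → ¬ P a b a' b') I ?_ M hu
  · exact (fin17 hR).finite_subsets.subset fun m hm e he => (hm.1 e he).2
  · intro m hm
    exact contsum7 ((fin17 hR).subset fun e he => (hm.1 e he).2) _
  · intro μ hμ m hmin a b c d h1 h2 hp
    exact improve17 hR hmin.1 h1 h2 (hP _ _ _ _ hp).1 _ ((hP _ _ _ _ hp).2 μ hμ) hmin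

theorem main27 {R B : Set ℝ} (hR : R.Finite) (hB : B.Finite) (P : ℝ → ℝ → ℝ → ℝ → Prop)
    (I : Set ℝ)
    (hP : ∀ a b c d, P a b c d → b ≠ d ∧ ∀ μ ∈ I,
      fgam μ (dist a d) + fgam μ (dist c b) < fgam μ (dist a b) + fgam μ (dist c d))
    (M : Set (ℝ × ℝ))
    (hu : ∀ M', (FinMin2 (fgam 1) R B M' ∧
      ∀ e ∈ M', ∀ e' ∈ M', ¬ P e.1 e.2 e'.1 e'.2) → M' = M) :
    ∃ ε : ℝ, 0 < ε ∧ ∀ μ ∈ I, |μ - 1| < ε →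
      FinMin2 (fgam μ) R B M ∧ ∀ M', FinMin2 (fgam μ) R B M' → M' = M := by
  refine core7 {m | IsMatch2 R B m} ?_ ⟨∅, by simp [IsMatch2]⟩ (unm2 R B)
    (fun μ m => cost2 (fgam μ) m)
    ?_ (fun M' => ∀ e ∈ M', ∀ e' ∈ M', ¬ P e.1 e.2 e'.1 e'.2) I ?_ M hu
  · exact (hR.prod hB).finite_subsets.subset fun m hm e he => hm.1 e he
  · intro m hm
    exact contsum7 ((hR.prod hB).subset fun e he => hm.1 e he) _
  · intro μ hμ m hmin e h1 e' h2 hp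
    exact improve27 hR hB hmin.1 h1 h2 (hP _ _ _ _ hp).1 _ ((hP _ _ _ _ hp).2 μ hμ) hmin

/-- If `M` is the unique `(1+)`-minimal matching of fixed finite subset(s) of `ℝ`,
then for all `μ > 1` sufficiently close to `1`, `M` is the unique `μ`-minimal
matching; similarly for `(1-)`-minimal matchings and `μ < 1`
(1-colour and 2-colour cases). -/
theorem stmt_7 :
    (∀ R : Set ℝ, R.Finite →
      ∀ M : Set (Sym2 ℝ), OnePlusMin1 R M → (∀ M', OnePlusMin1 R M' → M' = M) →
        ∃ ε : ℝ, 0 < ε ∧ ∀ μ : ℝ, 1 < μ → μ < 1 + ε →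
          FinMin1 (fgam μ) R M ∧ ∀ M', FinMin1 (fgam μ) R M' → M' = M) ∧
    (∀ R : Set ℝ, R.Finite →
      ∀ M : Set (Sym2 ℝ), OneMinusMin1 R M → (∀ M', OneMinusMin1 R M' → M' = M) →
        ∃ ε : ℝ, 0 < ε ∧ ∀ μ : ℝ, 1 - ε < μ → μ < 1 →
          FinMin1 (fgam μ) R M ∧ ∀ M', FinMin1 (fgam μ) R M' → M' = M) ∧
    (∀ R B : Set ℝ, R.Finite → B.Finite → Disjoint R B →
      ∀ M : Set (ℝ × ℝ), OnePlusMin2 R B M → (∀ M', OnePlusMin2 R B M' → M' = M) →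
        ∃ ε : ℝ, 0 < ε ∧ ∀ μ : ℝ, 1 < μ → μ < 1 + ε →
          FinMin2 (fgam μ) R B M ∧ ∀ M', FinMin2 (fgam μ) R B M' → M' = M) ∧
    (∀ R B : Set ℝ, R.Finite → B.Finite → Disjoint R B →
      ∀ M : Set (ℝ × ℝ), OneMinusMin2 R B M → (∀ M', OneMinusMin2 R B M' → M' = M) →
        ∃ ε : ℝ, 0 < ε ∧ ∀ μ : ℝ, 1 - ε < μ → μ < 1 →
          FinMin2 (fgam μ) R B M ∧ ∀ M', FinMin2 (fgam μ) R B M' → M' = M) := by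
  refine ⟨?_, ?_, ?_, ?_⟩
  · intro R hR M _ hu
    obtain ⟨ε, hε, h⟩ := main17 hR StraddleP (Set.Ioi 1)
      (fun a b c d h => ⟨(straddle_ne7 h).1, fun μ hμ => straddle7 h hμ⟩) M hu
    exact ⟨ε, hε, fun μ h1 h2 => h μ h1 (by rw [abs_lt]; constructor <;> linarith)⟩
  · intro R hR M _ hu
    obtain ⟨ε, hε, h⟩ := main17 hR EntwinedP (Set.Ioo 0 1)
      (fun a b c d h => ⟨(entwined_ne7 h).1, fun μ hμ => entwined7 h hμ.1 hμ.2⟩) M hu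
    refine ⟨min ε 1, by positivity, fun μ h1 h2 => ?_⟩
    have := min_le_left ε 1
    have := min_le_right ε 1
    exact h μ ⟨by linarith, h2⟩ (by rw [abs_lt]; constructor <;> linarith)
  · intro R B hR hB _ M _ hu
    obtain ⟨ε, hε, h⟩ := main27 hR hB StraddleP (Set.Ioi 1)
      (fun a b c d h => ⟨(straddle_ne7 h).2, fun μ hμ => straddle7 h hμ⟩) M hu
    exact ⟨ε, hε, fun μ h1 h2 => h μ h1 (by rw [abs_lt]; constructor <;> linarith)⟩
  · intro R B hR hB _ M _ hu
    obtain ⟨ε, hε, h⟩ := main27 hR hB EntwinedP (Set.Ioo 0 1)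
      (fun a b c d h => ⟨(entwined_ne7 h).2, fun μ hμ => entwined7 h hμ.1 hμ.2⟩) M hu
    refine ⟨min ε 1, by positivity, fun μ h1 h2 => ?_⟩
    have := min_le_left ε 1
    have := min_le_right ε 1
    exact h μ ⟨by linarith, h2⟩ (by rw [abs_lt]; constructor <;> linarith)
end

section
/- Let f : (0,∞) → ℝ be continuously differentiable, non-decreasing and not constant. Suppose that for every finite set R ⊂ ℝ and every s > 0, a matching M is an f(·)-minimal 1-colour matching of R if and only if sM is an f(·)-minimal 1-colour matching of sR. Then there exist a, b, γ ∈ ℝ such that f(x) = a x^γ + b for all x > 0 if γ ≠ 0, or f(x) = a log x + b for all x > 0 if γ = 0. -/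
open Set

variable {α : Type*} [MetricSpace α]

/-- The image of a 1-colour matching of reals under scaling by `s`. -/
def scaleM (s : ℝ) (M : Set (Sym2 ℝ)) : Set (Sym2 ℝ) := (Sym2.map fun x => s * x) '' M

/-- `f` has the scale-invariance property: for every finite `R ⊂ ℝ` and `s > 0`,
`M` is `f`-minimal for `R` iff `sM` is `f`-minimal for `sR`. -/
def ScaleInv (f : ℝ → ℝ) : Prop :=
  ∀ R : Set ℝ, R.Finite → ∀ s : ℝ, 0 < s → ∀ M : Set (Sym2 ℝ),
    (FinMin1 f R M ↔ FinMin1 f ((fun x => s * x) '' R) (scaleM s M))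

lemma pair_facts (f : ℝ → ℝ) (x : Fin 5 → ℝ) (hx : Function.Injective x)
    (i j k l n : Fin 5) (hij : i ≠ j) (hik : i ≠ k) (hil : i ≠ l) (hin : i ≠ n)
    (hjk : j ≠ k) (hjl : j ≠ l) (hjn : j ≠ n) (hkl : k ≠ l) (hkn : k ≠ n) (hln : l ≠ n)
    (hall : ∀ z, z = i ∨ z = j ∨ z = k ∨ z = l ∨ z = n) :
    IsMatch1 (Set.range x) {s(x i, x j), s(x k, x l)} ∧
    unm1 (Set.range x) {s(x i, x j), s(x k, x l)} = 1 ∧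
    cost1 f {s(x i, x j), s(x k, x l)} = f |x i - x j| + f |x k - x l| := by
  have e : ∀ {p q : Fin 5}, p ≠ q → x p ≠ x q := fun h h' => h (hx h')
  have h1 := e hij; have h2 := e hik; have h3 := e hil; have h4 := e hin
  have h5 := e hjk; have h6 := e hjl; have h7 := e hjn; have h8 := e hkl
  have h9 := e hkn; have h10 := e hln
  refine ⟨⟨?_, ?_⟩, ?_, ?_⟩
  · intro e he
    rcases he with rfl | rfl
    · simp [h1]
    · simp [h8]
  · intro e he e' he' y hy hy'
    rcases he with rfl | rfl <;> rcases he' with rfl | rfl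
    · rfl
    · simp only [Sym2.mem_iff] at hy hy'; grind
    · simp only [Sym2.mem_iff] at hy hy'; grind
    · rfl
  · have : {y ∈ Set.range x | ¬ matched1 {s(x i, x j), s(x k, x l)} y} = {x n} := by
      ext y
      simp only [Set.mem_setOf_eq, Set.mem_range, Set.mem_singleton_iff, matched1,
        Set.mem_insert_iff, exists_eq_or_imp, exists_eq_left, Sym2.mem_iff]
      constructor
      · rintro ⟨⟨z, rfl⟩, h⟩
        rcases hall z with rfl | rfl | rfl | rfl | rfl <;> simp at h ⊢
      · rintro rfl
        refine ⟨⟨n, rfl⟩, ?_⟩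
        grind
    rw [unm1, this, Set.ncard_singleton]
  · have hne : s(x i, x j) ≠ s(x k, x l) := by
      simp only [ne_eq, Sym2.eq_iff]; grind
    rw [cost1, finsum_mem_pair hne]
    simp [edgeLen, Real.dist_eq]

lemma match_struct (x : Fin 5 → ℝ) (hx : Function.Injective x) (m : Set (Sym2 ℝ))
    (hm : IsMatch1 (Set.range x) m) (hu : unm1 (Set.range x) m ≤ 1) :
    ∃ i j k l n : Fin 5, i ≠ j ∧ i ≠ k ∧ i ≠ l ∧ i ≠ n ∧ j ≠ k ∧ j ≠ l ∧ j ≠ n ∧ k ≠ l ∧ k ≠ n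
      ∧ l ≠ n ∧ (∀ z, z = i ∨ z = j ∨ z = k ∨ z = l ∨ z = n) ∧
      m = {s(x i, x j), s(x k, x l)} := by
  have hun : ∀ p q : Fin 5, p ≠ q → (∃ r, s(x p, x r) ∈ m) ∨ (∃ r, s(x q, x r) ∈ m) := by
    intro p q hpq
    by_contra hcon
    push Not at hcon
    have key : ∀ p, (∀ r, s(x p, x r) ∉ m) → x p ∈ {y ∈ Set.range x | ¬ matched1 m y} := by
      intro p hp
      refine ⟨⟨p, rfl⟩, ?_⟩
      rintro ⟨e, he, hpe⟩
      obtain ⟨y, rfl⟩ := Sym2.mem_iff_exists.1 hpe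
      obtain ⟨r, rfl⟩ := (hm.1 _ he).2 y (by simp)
      exact hp r he
    have hfin : {y ∈ Set.range x | ¬ matched1 m y}.Finite :=
      (Set.finite_range x).subset (fun y hy => hy.1)
    exact hpq (hx ((Set.ncard_le_one hfin).1 hu _ (key p hcon.1) _ (key q hcon.2)))
  have hir : ∀ p q, s(x p, x q) ∈ m → p ≠ q := by
    rintro p q h rfl
    exact (hm.1 _ h).1 (by simp)
  have huniq : ∀ p q r t : Fin 5, s(x p, x q) ∈ m → s(x r, x t) ∈ m →
      (p = r ∨ p = t ∨ q = r ∨ q = t) → (p = r ∧ q = t) ∨ (p = t ∧ q = r) := by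
    intro p q r t h h' hh
    have : s(x p, x q) = s(x r, x t) := by
      rcases hh with rfl | rfl | rfl | rfl
      · exact hm.2 _ h _ h' (x p) (by simp) (by simp)
      · exact hm.2 _ h _ h' (x p) (by simp) (by simp)
      · exact hm.2 _ h _ h' (x q) (by simp) (by simp)
      · exact hm.2 _ h _ h' (x q) (by simp) (by simp)
    simpa [Sym2.eq_iff, hx.eq_iff] using this
  obtain ⟨i, j, hijm⟩ : ∃ i j, s(x i, x j) ∈ m := by
    rcases hun 0 1 (by decide) with ⟨r, h⟩ | ⟨r, h⟩ <;> exact ⟨_, _, h⟩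
  have hij := hir _ _ hijm
  have hc : ∀ i j : Fin 5, i ≠ j → ∃ p q, p ≠ q ∧ p ≠ i ∧ p ≠ j ∧ q ≠ i ∧ q ≠ j := by decide
  obtain ⟨k, l, hklm, hki, hkj⟩ : ∃ k l, s(x k, x l) ∈ m ∧ k ≠ i ∧ k ≠ j := by
    obtain ⟨p, q, hpq, h1, h2, h3, h4⟩ := hc i j hij
    rcases hun p q hpq with ⟨r, h⟩ | ⟨r, h⟩
    · exact ⟨_, _, h, h1, h2⟩
    · exact ⟨_, _, h, h3, h4⟩
  have hkl := hir _ _ hklm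
  have hli : l ≠ i := by
    intro h; have := huniq _ _ _ _ hijm hklm (by simp [h]); grind
  have hlj : l ≠ j := by
    intro h; have := huniq _ _ _ _ hijm hklm (by simp [h]); grind
  have hn : ∀ i j k l : Fin 5, i ≠ j → i ≠ k → i ≠ l → j ≠ k → j ≠ l → k ≠ l →
      ∃ n, i ≠ n ∧ j ≠ n ∧ k ≠ n ∧ l ≠ n ∧ (∀ z, z = i ∨ z = j ∨ z = k ∨ z = l ∨ z = n) := by
    decide
  obtain ⟨n, h1, h2, h3, h4, hall⟩ := hn i j k l hij hki.symm hli.symm hkj.symm hlj.symm hkl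
  refine ⟨i, j, k, l, n, hij, hki.symm, hli.symm, h1, hkj.symm, hlj.symm, h2, hkl, h3, h4,
    hall, ?_⟩
  apply Set.Subset.antisymm
  · intro e he
    induction e using Sym2.ind with
    | _ y w =>
      obtain ⟨p, rfl⟩ := (hm.1 _ he).2 y (by simp)
      obtain ⟨q, rfl⟩ := (hm.1 _ he).2 w (by simp)
      have hpq := hir _ _ he
      have : (p = i ∨ p = j ∨ q = i ∨ q = j) ∨ (p = k ∨ p = l ∨ q = k ∨ q = l) := by
        have := hall p; have := hall q; grind
      simp only [Set.mem_insert_iff, Set.mem_singleton_iff, Sym2.eq_iff, hx.eq_iff]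
      rcases this with h | h
      · exact Or.inl (huniq _ _ _ _ he hijm h)
      · exact Or.inr (huniq _ _ _ _ he hklm h)
  · rintro e (rfl | rfl)
    · exact hijm
    · exact hklm

noncomputable def pts (a b c d : ℝ) : Fin 5 → ℝ := ![0, a, a+b, a+b+c, a+b+c+d]

lemma D_bound (D : Fin 5 → Fin 5 → ℝ) (hs : ∀ i j, D i j = D j i) (L : ℝ)
    (h1 : L ≤ D 0 1 + D 2 3) (h2 : L ≤ D 0 1 + D 2 4) (h3 : L ≤ D 0 1 + D 3 4)
    (h4 : L ≤ D 0 2 + D 1 3) (h5 : L ≤ D 0 2 + D 1 4) (h6 : L ≤ D 0 2 + D 3 4)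
    (h7 : L ≤ D 0 3 + D 1 2) (h8 : L ≤ D 0 3 + D 1 4) (h9 : L ≤ D 0 3 + D 2 4)
    (h10 : L ≤ D 0 4 + D 1 2) (h11 : L ≤ D 0 4 + D 1 3) (h12 : L ≤ D 0 4 + D 2 3)
    (h13 : L ≤ D 1 2 + D 3 4) (h14 : L ≤ D 1 3 + D 2 4) (h15 : L ≤ D 1 4 + D 2 3)
    (i j k l : Fin 5) (hij : i ≠ j) (hik : i ≠ k) (hil : i ≠ l)
    (hjk : j ≠ k) (hjl : j ≠ l) (hkl : k ≠ l) : L ≤ D i j + D k l := by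
  wlog h : i < j generalizing i j
  · rw [hs i j]
    exact this j i hij.symm hjk hjl hik hil (lt_of_le_of_ne (not_lt.1 h) hij.symm)
  wlog h' : k < l generalizing k l
  · rw [hs k l]
    apply this l k <;> omega
  wlog h'' : i < k generalizing i j k l
  · rw [add_comm]
    apply this k l <;> omega
  have := (by decide : ∀ i j k l : Fin 5, i < j → k < l → i < k → j ≠ k → j ≠ l →
    (i,j,k,l) ∈ [((0:Fin 5),(1:Fin 5),(2:Fin 5),(3:Fin 5)),(0,1,2,4),(0,1,3,4),(0,2,1,3),(0,2,1,4),
     (0,2,3,4),(0,3,1,2),(0,3,1,4),(0,3,2,4),(0,4,1,2),(0,4,1,3),(0,4,2,3),(1,2,3,4),(1,3,2,4),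
     (1,4,2,3)]) i j k l h h' h'' hjk hjl
  simp only [List.mem_cons, Prod.mk.injEq, List.not_mem_nil, or_false] at this
  rcases this with h | h | h | h | h | h | h | h | h | h | h | h | h | h | h <;>
    obtain ⟨rfl, rfl, rfl, rfl⟩ := h <;> assumption

lemma pts_strict (a b c d : ℝ) (ha : 0 < a) (hb : 0 < b) (hc : 0 < c) (hd : 0 < d) :
    StrictMono (pts a b c d) := by
  rw [Fin.strictMono_iff_lt_succ]
  intro i
  fin_cases i <;> simp [pts] <;> linarith

lemma five_min (f : ℝ → ℝ) (hf : MonotoneOn f (Set.Ioi 0)) (a b c d : ℝ)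
    (hb : 0 < b) (hc : 0 < c) (hba : b ≤ a) (hcd : c ≤ d) (h1 : a ≤ b + c + d)
    (h2 : d ≤ a + b + c) :
    FinMin1 f (Set.range (pts a b c d)) {s(pts a b c d 0, pts a b c d 1),
      s(pts a b c d 2, pts a b c d 3)} ↔ f a + f c ≤ f b + f d := by
  have ha : 0 < a := by linarith
  have hd : 0 < d := by linarith
  have hinj := (pts_strict a b c d ha hb hc hd).injective
  obtain ⟨M1, M2, M3⟩ := pair_facts f _ hinj 0 1 2 3 4 (by decide) (by decide) (by decide)
    (by decide) (by decide) (by decide) (by decide) (by decide) (by decide) (by decide) (by decide)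
  obtain ⟨N1, N2, N3⟩ := pair_facts f _ hinj 1 2 3 4 0 (by decide) (by decide) (by decide)
    (by decide) (by decide) (by decide) (by decide) (by decide) (by decide) (by decide) (by decide)
  set x := pts a b c d with hx
  have x0 : x 0 = 0 := rfl
  have x1 : x 1 = a := rfl
  have x2 : x 2 = a + b := rfl
  have x3 : x 3 = a + b + c := rfl
  have x4 : x 4 = a + b + c + d := rfl
  have ab : ∀ p q r : ℝ, 0 < r → q - p = r → |p - q| = r := by
    intro p q r hr h
    rw [abs_sub_comm, h, abs_of_pos hr]
  have d01 : |x 0 - x 1| = a := ab _ _ _ (by linarith) (by rw [x0, x1]; ring)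
  have d02 : |x 0 - x 2| = a + b := ab _ _ _ (by linarith) (by rw [x0, x2]; ring)
  have d03 : |x 0 - x 3| = a + b + c := ab _ _ _ (by linarith) (by rw [x0, x3]; ring)
  have d04 : |x 0 - x 4| = a + b + c + d := ab _ _ _ (by linarith) (by rw [x0, x4]; ring)
  have d12 : |x 1 - x 2| = b := ab _ _ _ (by linarith) (by rw [x1, x2]; ring)
  have d13 : |x 1 - x 3| = b + c := ab _ _ _ (by linarith) (by rw [x1, x3]; ring)
  have d14 : |x 1 - x 4| = b + c + d := ab _ _ _ (by linarith) (by rw [x1, x4]; ring)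
  have d23 : |x 2 - x 3| = c := ab _ _ _ (by linarith) (by rw [x2, x3]; ring)
  have d24 : |x 2 - x 4| = c + d := ab _ _ _ (by linarith) (by rw [x2, x4]; ring)
  have d34 : |x 3 - x 4| = d := ab _ _ _ (by linarith) (by rw [x3, x4]; ring)
  rw [d01, d23] at M3
  rw [d12, d34] at N3
  have mono : ∀ p q : ℝ, 0 < p → p ≤ q → f p ≤ f q := fun p q hp hpq =>
    hf hp (lt_of_lt_of_le hp hpq) hpq
  constructor
  · intro h
    have := h.2 _ N1
    rw [M2, N2, M3, N3] at this
    rcases this with h | h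
    · exact absurd h (lt_irrefl _)
    · exact h.2
  · intro h
    refine ⟨M1, ?_⟩
    intro m hm
    rw [M2, M3]
    by_cases hu : unm1 (Set.range x) m ≤ 1
    swap
    · exact Or.inl (not_le.1 hu)
    obtain ⟨i, j, k, l, n, e1, e2, e3, e4, e5, e6, e7, e8, e9, e10, hall, rfl⟩ :=
      match_struct x hinj m hm hu
    obtain ⟨P1, P2, P3⟩ := pair_facts f _ hinj i j k l n e1 e2 e3 e4 e5 e6 e7 e8 e9 e10 hall
    rw [P2, P3]
    refine Or.inr ⟨rfl, ?_⟩
    have m1 : f c ≤ f d := mono _ _ hc hcd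
    have m2 : f b ≤ f a := mono _ _ hb hba
    have m3 : f d ≤ f (c + d) := mono _ _ hd (by linarith)
    have m4 : f a ≤ f (a + b) := mono _ _ ha (by linarith)
    have m5 : f c ≤ f (b + c) := mono _ _ hc (by linarith)
    have m6 : f c ≤ f (b + c + d) := mono _ _ hc (by linarith)
    have m7 : f a ≤ f (b + c + d) := mono _ _ ha h1
    have m8 : f d ≤ f (a + b + c) := mono _ _ hd h2
    have m9 : f a ≤ f (a + b + c) := mono _ _ ha (by linarith)
    have m10 : f a ≤ f (a + b + c + d) := mono _ _ ha (by linarith)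
    have m11 : f d ≤ f (a + b + c + d) := mono _ _ hd (by linarith)
    have m12 : f b ≤ f (b + c) := mono _ _ hb (by linarith)
    refine D_bound (fun i j => f |x i - x j|) (fun i j => by simp only [abs_sub_comm]) _
      ?_ ?_ ?_ ?_ ?_ ?_ ?_ ?_ ?_ ?_ ?_ ?_ ?_ ?_ ?_ i j k l e1 e2 e3 e5 e6 e8 <;>
      simp only [d01, d02, d03, d04, d12, d13, d14, d23, d24, d34] <;> linarith

lemma scale_ineq (f : ℝ → ℝ) (hf : MonotoneOn f (Set.Ioi 0)) (hs : ScaleInv f) (s a b c d : ℝ)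
    (h0 : 0 < s) (hb : 0 < b) (hc : 0 < c) (hba : b ≤ a) (hcd : c ≤ d) (h1 : a ≤ b + c + d)
    (h2 : d ≤ a + b + c) (h : f a + f c ≤ f b + f d) :
    f (s * a) + f (s * c) ≤ f (s * b) + f (s * d) := by
  have hm := (five_min f hf a b c d hb hc hba hcd h1 h2).2 h
  rw [hs _ (Set.finite_range _) s h0] at hm
  have hp : ∀ i, s * pts a b c d i = pts (s*a) (s*b) (s*c) (s*d) i := by
    intro i
    fin_cases i <;> simp [pts] <;> ring
  rw [scaleM, Set.image_pair, Sym2.map_mk, Sym2.map_mk, ← Set.range_comp] at hm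
  have hp' : (fun x => s * x) ∘ pts a b c d = pts (s*a) (s*b) (s*c) (s*d) := funext hp
  simp only [hp, hp'] at hm
  refine (five_min f hf _ _ _ _ (by positivity) (by positivity) (by gcongr) (by gcongr)
    ?_ ?_).1 hm
  · nlinarith
  · nlinarith

lemma deriv_ineq (f : ℝ → ℝ) (hf : MonotoneOn f (Set.Ioi 0)) (hs : ScaleInv f)
    (hd : ∀ x, 0 < x → HasDerivAt f (deriv f x) x) (s x y u v : ℝ) (h0 : 0 < s)
    (hx : 0 < x) (hy : 0 < y) (hu : 0 < u) (hv : 0 < v)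
    (h : u * deriv f x < v * deriv f y) :
    u * deriv f (s * x) ≤ v * deriv f (s * y) := by
  have lin : ∀ z w : ℝ, 0 < z → HasDerivAt (fun t => f (z + t * w)) (deriv f z * w) 0 := by
    intro z w hz
    have h1 : HasDerivAt (fun t : ℝ => z + t * w) w 0 := by
      simpa using ((hasDerivAt_id (0:ℝ)).mul_const w).const_add z
    have h2 : HasDerivAt f (deriv f z) (z + 0 * w) := by simpa using hd z hz
    exact h2.comp 0 h1
  have A := ((lin y v hy).sub (lin x u hx)).tendsto_slope_zero_right
  have B := ((lin (s*y) (s*v) (by positivity)).sub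
    (lin (s*x) (s*u) (by positivity))).tendsto_slope_zero_right
  have A' := A.eventually (lt_mem_nhds (show 0 < deriv f y * v - deriv f x * u by linarith))
  have C1 : ∀ᶠ t : ℝ in nhdsWithin 0 (Set.Ioi 0), t * u < y :=
    (((continuous_id.mul continuous_const).tendsto' (0:ℝ) 0 (by simp)).mono_left
      nhdsWithin_le_nhds).eventually (gt_mem_nhds hy)
  have C2 : ∀ᶠ t : ℝ in nhdsWithin 0 (Set.Ioi 0), t * v < x :=
    (((continuous_id.mul continuous_const).tendsto' (0:ℝ) 0 (by simp)).mono_left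
      nhdsWithin_le_nhds).eventually (gt_mem_nhds hx)
  have D : 0 ≤ deriv f (s * y) * (s * v) - deriv f (s * x) * (s * u) := by
    refine ge_of_tendsto B ?_
    filter_upwards [A', C1, C2, self_mem_nhdsWithin] with t ht c1 c2 (tpos : 0 < t)
    have tu : 0 < t * u := by positivity
    have tv : 0 < t * v := by positivity
    simp only [Pi.sub_apply, zero_add, zero_mul, add_zero, smul_eq_mul] at ht ⊢
    have ht' := (pos_iff_pos_of_mul_pos ht).1 (inv_pos.2 tpos)
    have := scale_ineq f hf hs s (x + t * u) x y (y + t * v) h0 hx hy (by linarith) (by linarith)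
      (by linarith) (by linarith) (by linarith)
    apply mul_nonneg (inv_pos.2 tpos).le
    rw [show s * y + t * (s * v) = s * (y + t * v) by ring,
      show s * x + t * (s * u) = s * (x + t * u) by ring]
    linarith
  have E : 0 ≤ s * (v * deriv f (s * y) - u * deriv f (s * x)) := by linarith
  have := nonneg_of_mul_nonneg_right E h0
  linarith

lemma pow_of_mul (g : ℝ → ℝ) (hpos : ∀ x, 0 < x → 0 < g x) (hc : ContinuousOn g (Set.Ioi 0))
    (hmul : ∀ s x, 0 < s → 0 < x → g (s * x) * g 1 = g x * g s) :
    ∃ β : ℝ, ∀ x, 0 < x → g x = g 1 * x ^ β := by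
  have g1 := hpos 1 one_pos
  let φ : ℝ →+ ℝ := AddMonoidHom.mk' (fun t => Real.log (g (Real.exp t)) - Real.log (g 1)) (by
    intro a b
    have ha := hpos _ (Real.exp_pos a)
    have hb := hpos _ (Real.exp_pos b)
    have hab := hpos _ (mul_pos (Real.exp_pos a) (Real.exp_pos b))
    have := congrArg Real.log (hmul _ _ (Real.exp_pos a) (Real.exp_pos b))
    rw [Real.log_mul hab.ne' g1.ne', Real.log_mul hb.ne' ha.ne'] at this
    rw [Real.exp_add]
    linarith)
  have hφ : Continuous φ := by
    have : Continuous (fun t => g (Real.exp t)) :=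
      hc.comp_continuous Real.continuous_exp (fun t => Real.exp_pos t)
    exact (this.log (fun t => (hpos _ (Real.exp_pos t)).ne')).sub continuous_const
  refine ⟨φ 1, fun x hx => ?_⟩
  have h1 : φ (Real.log x) = Real.log x * φ 1 := by
    have := (φ.toRealLinearMap hφ).map_smul (Real.log x) 1
    simpa using this
  have h2 : φ (Real.log x) = Real.log (g x) - Real.log (g 1) := by
    change Real.log (g (Real.exp (Real.log x))) - _ = _
    rw [Real.exp_log hx]
  rw [Real.rpow_def_of_pos hx, ← h1, h2, Real.exp_sub, Real.exp_log (hpos x hx), Real.exp_log g1]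
  field_simp

lemma eq_add_const (f F : ℝ → ℝ) (f' : ℝ → ℝ) (hf : ∀ x, 0 < x → HasDerivAt f (f' x) x)
    (hF : ∀ x, 0 < x → HasDerivAt F (f' x) x) (x : ℝ) (hx : 0 < x) :
    f x = F x + (f 1 - F 1) := by
  have := (convex_Ioi (0:ℝ)).is_const_of_fderivWithin_eq_zero (𝕜 := ℝ) (f := fun x => f x - F x)
    (fun y hy => ((hf y hy).sub (hF y hy)).differentiableAt.differentiableWithinAt)
    (fun y hy => by
      have h := ((hf y hy).sub (hF y hy)).hasFDerivAt
      rw [sub_self] at h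
      have h2 := h.hasFDerivWithinAt (s := Set.Ioi 0)
      have h3 := h2.fderivWithin (isOpen_Ioi.uniqueDiffWithinAt hy)
      refine Eq.trans h3 ?_
      ext; simp) (x := x) (y := 1) hx
    (Set.mem_Ioi.2 one_pos)
  linarith

theorem stmt_8 (f : ℝ → ℝ)
    (hdiff : ContDiffOn ℝ 1 f (Set.Ioi 0))
    (hmono : MonotoneOn f (Set.Ioi 0))
    (hnonconst : ∃ x ∈ Set.Ioi (0 : ℝ), ∃ y ∈ Set.Ioi (0 : ℝ), f x ≠ f y)
    (hscale : ScaleInv f) :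
    ∃ a b γ : ℝ,
      (γ ≠ 0 ∧ ∀ x : ℝ, 0 < x → f x = a * x ^ γ + b) ∨
      (γ = 0 ∧ ∀ x : ℝ, 0 < x → f x = a * Real.log x + b) := by
  have hd : ∀ x, 0 < x → HasDerivAt f (deriv f x) x := fun x hx =>
    ((hdiff.differentiableOn one_ne_zero).differentiableAt (Ioi_mem_nhds hx)).hasDerivAt
  have hcont : ContinuousOn (deriv f) (Set.Ioi 0) :=
    hdiff.continuousOn_deriv_of_isOpen isOpen_Ioi le_rfl
  have hnn : ∀ x, 0 < x → 0 ≤ deriv f x := by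
    intro x hx
    refine ge_of_tendsto (hd x hx).tendsto_slope_zero_right ?_
    filter_upwards [self_mem_nhdsWithin] with t (ht : 0 < t)
    have := hmono (show x ∈ Set.Ioi 0 from hx) (show x + t ∈ Set.Ioi 0 from add_pos hx ht)
      (by linarith)
    exact mul_nonneg (inv_pos.2 ht).le (sub_nonneg.2 this)
  have key : ∀ s x y, 0 < s → 0 < x → 0 < y → 0 < deriv f y →
      deriv f (s * x) * deriv f y ≤ deriv f x * deriv f (s * y) := by
    intro s x y h0 hx hy hpos
    have h1 : ∀ δ : ℝ, 0 < δ →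
        deriv f (s * x) * deriv f y ≤ (deriv f x + δ) * deriv f (s * y) := by
      intro δ hδ
      have hxx := hnn x hx
      have := deriv_ineq f hmono hscale hd s x y (deriv f y) (deriv f x + δ) h0 hx hy hpos
        (by linarith) (by nlinarith)
      linarith
    have T : Filter.Tendsto (fun δ : ℝ => (deriv f x + δ) * deriv f (s * y))
        (nhdsWithin 0 (Set.Ioi 0)) (nhds (deriv f x * deriv f (s * y))) := by
      refine Filter.Tendsto.mono_left ?_ nhdsWithin_le_nhds
      exact (Continuous.tendsto' (by fun_prop) _ _ (by simp))
    refine ge_of_tendsto T ?_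
    filter_upwards [self_mem_nhdsWithin] with δ hδ using h1 δ hδ
  obtain ⟨x0, hx0, hp0⟩ : ∃ x0, 0 < x0 ∧ 0 < deriv f x0 := by
    by_contra hcon
    push Not at hcon
    obtain ⟨x, hx, y, hy, hxy⟩ := hnonconst
    have hz : ∀ z, 0 < z → HasDerivAt f 0 z := by
      intro z hz
      have := hd z hz
      rwa [le_antisymm (hcon z hz) (hnn z hz)] at this
    have e1 := eq_add_const f (fun _ => 0) (fun _ => 0) hz (fun z _ => hasDerivAt_const z 0) x hx
    have e2 := eq_add_const f (fun _ => 0) (fun _ => 0) hz (fun z _ => hasDerivAt_const z 0) y hy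
    exact hxy (e1.trans e2.symm)
  have hpos : ∀ x, 0 < x → 0 < deriv f x := by
    intro x hx
    refine lt_of_le_of_ne (hnn x hx) (fun h => ?_)
    have := key (x0 / x) x x0 (by positivity) hx hx0 hp0
    rw [div_mul_cancel₀ _ hx.ne', ← h, zero_mul] at this
    nlinarith
  obtain ⟨β, hβ⟩ := pow_of_mul (deriv f) hpos hcont (by
    intro s x h0 hx
    have h1 := key s x 1 h0 hx one_pos (hpos 1 one_pos)
    have h2 := key s 1 x h0 one_pos hx (hpos x hx)
    rw [mul_one] at h1 h2
    linarith)
  have hd' : ∀ x, 0 < x → HasDerivAt f (deriv f 1 * x ^ β) x := fun x hx => by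
    rw [← hβ x hx]; exact hd x hx
  by_cases hβ1 : β + 1 = 0
  · refine ⟨deriv f 1, f 1 - deriv f 1 * Real.log 1, 0, Or.inr ⟨rfl, ?_⟩⟩
    refine eq_add_const f (fun x => deriv f 1 * Real.log x) _ hd' ?_
    intro x hx
    have : x ^ β = x⁻¹ := by
      rw [show β = -1 by linarith, Real.rpow_neg_one]
    simp only [this]
    exact (Real.hasDerivAt_log hx.ne').const_mul _
  · refine ⟨deriv f 1 / (β + 1), f 1 - deriv f 1 / (β + 1) * (1:ℝ) ^ (β + 1), β + 1,
      Or.inl ⟨hβ1, ?_⟩⟩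
    refine eq_add_const f (fun x => deriv f 1 / (β + 1) * x ^ (β + 1)) _ hd' ?_
    intro x hx
    have := (Real.hasDerivAt_rpow_const (p := β + 1) (Or.inl hx.ne')).const_mul
      (deriv f 1 / (β + 1))
    rw [add_sub_cancel_right, ← mul_assoc, div_mul_cancel₀ _ hβ1] at this
    exact this
end
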